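/- arXiv:2212.13409 — 13 statements merged into one kernel-verified Lean document; each statement's English description precedes it below -/
import Mathlib

section
/- A nonempty topological space X is ultranormal if and only if X has covering dimension 0, i.e., every finite open cover of X admits a refinement consisting of finitely many pairwise disjoint open subsets of X that cover X. -/
/-- A topological space is *ultranormal* if every pair of disjoint closed sets can be
separated by a clopen set. -/
def Ultranormal (X : Type*) [TopologicalSpace X] : Prop :=
  ∀ A B : Set X, IsClosed A → IsClosed B → Disjoint A B →
    ∃ C : Set X, IsClopen C ∧ A ⊆ C ∧ Disjoint C B

/-- A topological space has covering dimension zero if it is nonempty and every finite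
open cover admits a refinement by finitely many pairwise disjoint open sets covering the
space. -/
def CovDimZero (X : Type*) [TopologicalSpace X] : Prop :=
  Nonempty X ∧
    ∀ 𝒰 : Finset (Set X), (∀ U ∈ 𝒰, IsOpen U) → ⋃₀ (𝒰 : Set (Set X)) = Set.univ →
      ∃ 𝒱 : Finset (Set X), (∀ V ∈ 𝒱, IsOpen V) ∧
        (∀ V ∈ 𝒱, ∀ W ∈ 𝒱, V ≠ W → Disjoint V W) ∧
        ⋃₀ (𝒱 : Set (Set X)) = Set.univ ∧
        ∀ V ∈ 𝒱, ∃ U ∈ 𝒰, V ⊆ U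

/-- In an ultranormal space, every clopen set covered by finitely many open sets is a finite
disjoint union of open sets subordinate to the cover. -/
theorem Ultranormal.exists_disjoint_refinement {X : Type*} [TopologicalSpace X]
    (hX : Ultranormal X) (𝒰 : Finset (Set X)) (hU : ∀ U ∈ 𝒰, IsOpen U)
    {K : Set X} (hK : IsClopen K) (hKU : K ⊆ ⋃₀ (𝒰 : Set (Set X))) :
    ∃ 𝒱 : Finset (Set X), (∀ V ∈ 𝒱, IsOpen V) ∧
      (∀ V ∈ 𝒱, ∀ W ∈ 𝒱, V ≠ W → Disjoint V W) ∧
      ⋃₀ (𝒱 : Set (Set X)) = K ∧ ∀ V ∈ 𝒱, ∃ U ∈ 𝒰, V ⊆ U := by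
  classical
  induction 𝒰 using Finset.induction_on generalizing K with
  | empty =>
    have hK_empty : K = ∅ := by simpa using hKU
    exact ⟨∅, by simp [hK_empty]⟩
  | insert U 𝒰 _ ih =>
    have hU_open : IsOpen U := hU U (Finset.mem_insert_self U 𝒰)
    have h𝒰_open : ∀ W ∈ 𝒰, IsOpen W := fun W hW => hU W (Finset.mem_insert_of_mem hW)
    obtain ⟨C, hC, hAC, hCU⟩ := hX (K \ ⋃₀ (𝒰 : Set (Set X))) Uᶜ
      (hK.isClosed.sdiff (isOpen_sUnion h𝒰_open)) hU_open.isClosed_compl (by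
        rw [Set.disjoint_compl_right_iff_subset]
        rintro x ⟨hxK, hx⟩
        rw [Finset.coe_insert, Set.sUnion_insert] at hKU
        exact (hKU hxK).resolve_right hx)
    rw [Set.disjoint_compl_right_iff_subset] at hCU
    obtain ⟨𝒱, hV_open, hV_disj, hV_union, hV_sub⟩ := ih h𝒰_open (hK.diff hC) (by
      rintro x ⟨hxK, hxC⟩
      by_contra hx
      exact hxC (hAC ⟨hxK, hx⟩))
    have h_disj : ∀ V ∈ 𝒱, Disjoint (K ∩ C) V := fun V hV =>
      (Set.disjoint_sdiff_right.mono_left Set.inter_subset_right).mono_right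
        (hV_union ▸ Set.subset_sUnion_of_mem hV : V ⊆ K \ C)
    refine ⟨insert (K ∩ C) 𝒱, ?_, ?_, ?_, ?_⟩
    · exact (Finset.forall_mem_insert _ _ _).2 ⟨hK.isOpen.inter hC.isOpen, hV_open⟩
    · intro V hV W hW hVW
      rcases Finset.mem_insert.1 hV with rfl | hV <;> rcases Finset.mem_insert.1 hW with rfl | hW
      · exact absurd rfl hVW
      · exact h_disj W hW
      · exact (h_disj V hV).symm
      · exact hV_disj V hV W hW hVW
    · rw [Finset.coe_insert, Set.sUnion_insert, hV_union, Set.inter_union_sdiff]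
    · refine (Finset.forall_mem_insert _ _ _).2
        ⟨⟨U, Finset.mem_insert_self U 𝒰, Set.inter_subset_right.trans hCU⟩, fun V hV => ?_⟩
      obtain ⟨W, hW, hVW⟩ := hV_sub V hV
      exact ⟨W, Finset.mem_insert_of_mem hW, hVW⟩

theorem CovDimZero.ultranormal {X : Type*} [TopologicalSpace X] (hX : CovDimZero X) :
    Ultranormal X := by
  classical
  intro A B hA hB hAB
  obtain ⟨𝒱, hV_open, hV_disj, hV_union, hV_sub⟩ := hX.2 {Aᶜ, Bᶜ}
    (by simp [hA.isOpen_compl, hB.isOpen_compl])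
    (by simp [← Set.compl_inter, hAB.inter_eq])
  have h_cover : ∀ x, ∃ V ∈ 𝒱, x ∈ V := fun x => by
    simpa using hV_union.ge (Set.mem_univ x)
  have h_compl : (⋃₀ {V | V ∈ 𝒱 ∧ ¬ V ⊆ Aᶜ})ᶜ = ⋃₀ {V | V ∈ 𝒱 ∧ V ⊆ Aᶜ} := by
    ext x
    obtain ⟨V, hV, hxV⟩ := h_cover x
    constructor
    · intro hx
      exact ⟨V, ⟨hV, by_contra fun h => hx ⟨V, ⟨hV, h⟩, hxV⟩⟩, hxV⟩
    · rintro ⟨W, ⟨hW, hWA⟩, hxW⟩ ⟨W', ⟨hW', hWA'⟩, hxW'⟩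
      exact Set.disjoint_left.1 (hV_disj W hW W' hW' fun h => hWA' (h ▸ hWA)) hxW hxW'
  refine ⟨⋃₀ {V | V ∈ 𝒱 ∧ ¬ V ⊆ Aᶜ}, ⟨⟨?_⟩, ?_⟩, ?_, ?_⟩
  · rw [h_compl]
    exact isOpen_sUnion fun V hV => hV_open V hV.1
  · exact isOpen_sUnion fun V hV => hV_open V hV.1
  · intro x hx
    obtain ⟨V, hV, hxV⟩ := h_cover x
    exact ⟨V, ⟨hV, fun h => h hxV hx⟩, hxV⟩
  · rw [Set.disjoint_sUnion_left]
    rintro V ⟨hV, hVA⟩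
    obtain ⟨U, hU, hVU⟩ := hV_sub V hV
    rcases Finset.mem_insert.1 hU with rfl | hU
    · exact absurd hVU hVA
    · rw [Finset.mem_singleton.1 hU] at hVU
      exact Set.subset_compl_iff_disjoint_right.1 hVU

theorem ultranormal_iff_covDimZero (X : Type*) [TopologicalSpace X] [Nonempty X] :
    Ultranormal X ↔ CovDimZero X := by
  refine ⟨fun hX => ⟨inferInstance, fun 𝒰 hU hcover => ?_⟩, CovDimZero.ultranormal⟩
  exact hX.exists_disjoint_refinement 𝒰 hU isClopen_univ hcover.ge
end

section
/- Let X be a metrizable topological space and A a nonempty closed subset of X such that the subspace X \ A is ultranormal. Then for every open set U of X with A ⊆ U there exists a clopen subset V of X with A ⊆ V and V ⊆ U. -/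
theorem clopen_sandwich {X : Type*} [TopologicalSpace X] [TopologicalSpace.MetrizableSpace X]
    (A : Set X) (hAne : A.Nonempty) (hAcl : IsClosed A) (hun : Ultranormal ↥(Aᶜ)) :
    ∀ U : Set X, IsOpen U → A ⊆ U →
      ∃ V : Set X, IsClopen V ∧ A ⊆ V ∧ V ⊆ U := by
  intro U hU hAU
  let _ := TopologicalSpace.metrizableSpaceMetric X
  obtain ⟨W, hW, hAW, hWU⟩ := normal_exists_closure_subset hAcl hU hAU
  obtain ⟨C, hC, hPC, hCQ⟩ := hun (Subtype.val ⁻¹' closure W) (Subtype.val ⁻¹' Uᶜ)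
    (isClosed_closure.preimage continuous_subtype_val)
    (hU.isClosed_compl.preimage continuous_subtype_val)
    (Disjoint.preimage _ (Set.disjoint_compl_right_iff_subset.2 hWU))
  have open_image : ∀ {D : Set ↥(Aᶜ)}, IsOpen D → IsOpen (Subtype.val '' D) :=
    fun hD => hAcl.isOpen_compl.isOpenMap_subtype_val _ hD
  have hV : W ∪ Subtype.val '' C = (Subtype.val '' Cᶜ)ᶜ := by
    ext x
    by_cases hx : x ∈ A
    · simp [hx, hAW hx]
    · have hWC : x ∈ W → ⟨x, hx⟩ ∈ C := fun h => hPC (subset_closure h)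
      simpa [hx] using hWC
  refine ⟨W ∪ Subtype.val '' C, ⟨?_, hW.union (open_image hC.isOpen)⟩,
    hAW.trans Set.subset_union_left, Set.union_subset (subset_closure.trans hWU) ?_⟩
  · rw [hV]
    exact (open_image hC.compl.isOpen).isClosed_compl
  · rintro _ ⟨x, hx, rfl⟩
    by_contra hxU
    exact Set.disjoint_left.1 hCQ hx hxU
end

section
/- Every separable metrizable topological space X in which every pair of disjoint closed subsets can be separated by a clopen set (i.e., X is ultranormal, equivalently zero-dimensional) admits a topological embedding into the Cantor space ℕ → Bool (the countable product of the two-point discrete space). -/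
open TopologicalSpace Topology

theorem Ultranormal.isTopologicalBasis_isClopen {X : Type*} [TopologicalSpace X] [T1Space X]
    (hun : Ultranormal X) : IsTopologicalBasis {s : Set X | IsClopen s} := by
  refine isTopologicalBasis_of_isOpen_of_nhds (fun s hs => hs.isOpen) fun x U hxU hU => ?_
  obtain ⟨C, hC, hxC, hCU⟩ := hun {x} Uᶜ isClosed_singleton hU.isClosed_compl
    (Set.disjoint_singleton_left.2 fun h => h hxU)
  exact ⟨C, hC, hxC rfl, Set.disjoint_compl_right_iff_subset.1 hCU⟩

/-- The map recording membership in the members of a clopen basis is an embedding. -/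
theorem TopologicalSpace.IsTopologicalBasis.isEmbedding_boolIndicator {X ι : Type*}
    [TopologicalSpace X] [T0Space X] {C : ι → Set X} (hb : IsTopologicalBasis (Set.range C))
    (hC : ∀ i, IsClopen (C i)) : IsEmbedding fun (x : X) (i : ι) => (C i).boolIndicator x := by
  have hcont : Continuous fun (x : X) (i : ι) => (C i).boolIndicator x :=
    continuous_pi fun i => (continuous_boolIndicator_iff_isClopen _).2 (hC i)
  refine IsInducing.isEmbedding ⟨le_antisymm hcont.le_induced ?_⟩
  rw [hb.eq_generateFrom]
  refine le_generateFrom ?_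
  rintro _ ⟨i, rfl⟩
  have hopen : IsOpen ((fun g : ι → Bool => g i) ⁻¹' {true}) :=
    (isOpen_discrete _).preimage (continuous_apply i)
  exact ⟨_, hopen, (C i).preimage_boolIndicator_true⟩

theorem embed_into_cantor {X : Type*} [TopologicalSpace X]
    [TopologicalSpace.MetrizableSpace X] [TopologicalSpace.SeparableSpace X]
    (hun : Ultranormal X) :
    ∃ f : X → (ℕ → Bool), Topology.IsEmbedding f := by
  rcases isEmpty_or_nonempty X with _ | ⟨⟨x⟩⟩
  · exact ⟨isEmptyElim, .of_subsingleton _⟩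
  have : SecondCountableTopology X := by
    let := metrizableSpaceMetric X
    exact UniformSpace.secondCountable_of_separable X
  obtain ⟨b, hb, hbc, hbasis⟩ := hun.isTopologicalBasis_isClopen.exists_countable
  obtain ⟨s, hs, -⟩ := hbasis.exists_subset_of_mem_open (Set.mem_univ x) isOpen_univ
  obtain ⟨C, rfl⟩ := hbc.exists_eq_range ⟨s, hs⟩
  exact ⟨_, hbasis.isEmbedding_boolIndicator fun n => hb ⟨n, rfl⟩⟩
end

section
/- Let (X, d) be a complete metric space and F a nonempty closed subset of X. Then the metric quotient X/F, i.e., the separation quotient of X equipped with the pseudometric e_F(x, y) = min(d(x, y), infDist(x, F) + infDist(y, F)) together with its induced metric, is a complete metric space. Equivalently, every sequence in X that is Cauchy with respect to e_F has a subsequence (x_{φ(i)}) and a point l ∈ X with e_F(x_{φ(i)}, l) → 0. -/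
open Filter

theorem quotient_pseudometric_complete {X : Type*} [MetricSpace X] [CompleteSpace X]
    (F : Set X) (hFne : F.Nonempty) (hFcl : IsClosed F) :
    let e : X → X → ℝ := fun x y => min (dist x y) (Metric.infDist x F + Metric.infDist y F)
    ∀ x : ℕ → X,
      (∀ ε : ℝ, 0 < ε → ∃ N : ℕ, ∀ m ≥ N, ∀ n ≥ N, e (x m) (x n) < ε) →
      ∃ φ : ℕ → ℕ, StrictMono φ ∧
        ∃ l : X, Tendsto (fun i => e (x (φ i)) l) atTop (nhds 0) := by
  intro e x hx
  have e_nonneg (a b : X) : 0 ≤ e a b :=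
    le_min dist_nonneg (add_nonneg Metric.infDist_nonneg Metric.infDist_nonneg)
  by_cases hF : ∀ ε : ℝ, 0 < ε → ∃ᶠ n in atTop, Metric.infDist (x n) F < ε
  · -- The sequence accumulates at `F`, so a subsequence converges to the collapsed point.
    obtain ⟨φ, hφ, hlt⟩ := extraction_forall_of_frequently
      (fun k : ℕ => hF (1 / ((k : ℝ) + 1)) Nat.one_div_pos_of_nat)
    obtain ⟨l, hl⟩ := hFne
    refine ⟨φ, hφ, l, squeeze_zero (fun _ => e_nonneg _ _) (fun i => ?_)
      tendsto_one_div_add_atTop_nhds_zero_nat⟩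
    refine (min_le_right _ _).trans ?_
    rw [Metric.infDist_zero_of_mem hl, add_zero]
    exact (hlt i).le
  · -- The sequence stays away from `F`, so it is Cauchy for the original metric.
    push Not at hF
    obtain ⟨ε, hε, hfar⟩ := hF
    obtain ⟨M, hM⟩ := eventually_atTop.1 hfar
    have hcauchy : CauchySeq x := by
      refine Metric.cauchySeq_iff.2 fun δ hδ => ?_
      obtain ⟨N, hN⟩ := hx (min δ ε) (lt_min hδ hε)
      refine ⟨max M N, fun m hm n hn => ?_⟩
      have hm' := hM m (le_of_max_le_left hm)
      have hn' := hM n (le_of_max_le_left hn)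
      have hlt := hN m (le_of_max_le_right hm) n (le_of_max_le_right hn)
      rcases min_lt_iff.1 hlt with h | h
      · exact h.trans_le (min_le_left _ _)
      · have := h.trans_le (min_le_right _ _)
        linarith
    obtain ⟨l, hl⟩ := cauchySeq_tendsto_of_complete hcauchy
    exact ⟨id, strictMono_id, l, squeeze_zero (fun _ => e_nonneg _ _)
      (fun _ => min_le_left _ _) (tendsto_iff_dist_tendsto_zero.1 hl)⟩
end

section
/- Let (X, d) be a metric space and F a nonempty closed subset of X such that the subspace X \ F is ultranormal. Then the metric quotient X/F (the separation quotient of X with the pseudometric e_F(x, y) = min(d(x, y), infDist(x, F) + infDist(y, F)), with its induced metric topology) is ultranormal; in particular it has covering dimension 0. -/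
/-- In a regular space `Q` covered by an ultranormal open subspace and one further point `θ`,
a closed set avoiding `θ` has a clopen neighbourhood disjoint from any given closed set that is
disjoint from it. -/
theorem Ultranormal.exists_isClopen_of_notMem {U Q : Type*} [TopologicalSpace U]
    [TopologicalSpace Q] [RegularSpace Q] (hU : Ultranormal U) {j : U → Q}
    (hj : Topology.IsOpenEmbedding j) {θ : Q} (hθ : ∀ q, q ≠ θ → q ∈ Set.range j)
    {A B : Set Q} (hA : IsClosed A) (hB : IsClosed B) (hAB : Disjoint A B) (hθB : θ ∉ B) :
    ∃ D : Set Q, IsClopen D ∧ B ⊆ D ∧ Disjoint D A := by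
  obtain ⟨K, ⟨hKθ, hKcl⟩, hKB⟩ :=
    (closed_nhds_basis θ).mem_iff.1 (hB.isOpen_compl.mem_nhds hθB)
  obtain ⟨D, hD, hBD, hDAK⟩ := hU (j ⁻¹' B) (j ⁻¹' (A ∪ K)) (hB.preimage hj.continuous)
    ((hA.union hKcl).preimage hj.continuous)
    (Disjoint.preimage j (Set.disjoint_union_right.2
      ⟨hAB.symm, (Set.disjoint_left.2 fun _ hk hb => hKB hk hb).symm⟩))
  have hDK : ∀ u ∈ D, j u ∉ A ∪ K := fun u hu => Set.disjoint_left.1 hDAK hu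
  refine ⟨j '' D, ⟨?_, hj.isOpenMap D hD.isOpen⟩, ?_, ?_⟩
  · have hcompl : (j '' D)ᶜ = j '' Dᶜ ∪ interior K := by
      ext q
      constructor
      · intro hq
        by_cases hqθ : q = θ
        · exact Or.inr (hqθ ▸ mem_interior_iff_mem_nhds.2 hKθ)
        · obtain ⟨u, rfl⟩ := hθ q hqθ
          exact Or.inl ⟨u, fun hu => hq ⟨u, hu, rfl⟩, rfl⟩
      · rintro (⟨u, hu, rfl⟩ | hq) ⟨v, hv, hvq⟩
        · exact hu (hj.injective hvq ▸ hv)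
        · exact hDK v hv (Or.inr (hvq ▸ interior_subset hq))
    rw [← isOpen_compl_iff, hcompl]
    exact (hj.isOpenMap _ hD.compl.isOpen).union isOpen_interior
  · intro q hq
    obtain ⟨u, rfl⟩ := hθ q fun h => hθB (h ▸ hq)
    exact ⟨u, hBD hq, rfl⟩
  · rw [Set.disjoint_left]
    rintro _ ⟨u, hu, rfl⟩ hA'
    exact hDK u hu (Or.inl hA')

/-- A regular space covered by an ultranormal open subspace and one further point is
ultranormal. -/
theorem Ultranormal.of_isOpenEmbedding {U Q : Type*} [TopologicalSpace U]
    [TopologicalSpace Q] [RegularSpace Q] (hU : Ultranormal U) {j : U → Q}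
    (hj : Topology.IsOpenEmbedding j) {θ : Q} (hθ : ∀ q, q ≠ θ → q ∈ Set.range j) :
    Ultranormal Q := by
  intro A B hA hB hAB
  by_cases hθB : θ ∈ B
  · exact hU.exists_isClopen_of_notMem hj hθ hB hA hAB.symm
      fun hθA => Set.disjoint_left.1 hAB hθA hθB
  · obtain ⟨D, hD, hBD, hDA⟩ := hU.exists_isClopen_of_notMem hj hθ hA hB hAB hθB
    exact ⟨Dᶜ, hD.compl, hDA.symm.subset_compl_right,
      Set.disjoint_left.2 fun _ hc hb => hc (hBD hb)⟩

/-- The projection to the metric quotient `X/F` is an open embedding on `Fᶜ`. -/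
theorem isOpenEmbedding_domRestrict_compl_of_dist_eq {X Q : Type*} [MetricSpace X] [MetricSpace Q]
    {F : Set X} (hFne : F.Nonempty) (hFcl : IsClosed F) {π : X → Q}
    (hsurj : Function.Surjective π)
    (hπ : ∀ x y : X, dist (π x) (π y) =
      min (dist x y) (Metric.infDist x F + Metric.infDist y F)) :
    Topology.IsOpenEmbedding (Fᶜ.domRestrict π) := by
  have hpos : ∀ x ∉ F, 0 < Metric.infDist x F := fun x hx =>
    (hFcl.notMem_iff_infDist_pos hFne).1 hx
  have hcont : Continuous π := (LipschitzWith.of_dist_le_mul (K := 1) fun x y => by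
    rw [hπ]; simp).continuous
  refine .of_continuous_injective_isOpenMap (hcont.comp continuous_subtype_val) ?_ ?_
  · rintro ⟨x, hx⟩ ⟨y, hy⟩ hxy
    have h := hπ x y
    rw [show π x = π y from hxy, dist_self] at h
    rcases min_choice (dist x y) (Metric.infDist x F + Metric.infDist y F) with h' | h'
    · exact Subtype.ext (dist_eq_zero.1 (h'.symm.trans h.symm))
    · linarith [hpos x hx, hpos y hy]
  · intro V hV
    rw [Metric.isOpen_iff]
    rintro _ ⟨⟨x, hx⟩, hxV, rfl⟩
    obtain ⟨ε, hε, hball⟩ := Metric.isOpen_iff.1 hV _ hxV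
    refine ⟨min ε (Metric.infDist x F), lt_min hε (hpos x hx), fun q hq => ?_⟩
    obtain ⟨y, rfl⟩ := hsurj q
    have hlt : dist (π y) (π x) < min ε (Metric.infDist x F) := hq
    rw [hπ, lt_min_iff, min_lt_iff, min_lt_iff] at hlt
    have hy0 : 0 ≤ Metric.infDist y F := Metric.infDist_nonneg
    have hyx : dist y x < Metric.infDist x F := hlt.2.resolve_right (by linarith)
    have hyF : y ∉ F := fun hy => by
      linarith [Metric.infDist_le_dist_of_mem (x := x) hy, dist_comm x y]
    refine ⟨⟨y, hyF⟩, hball ?_, rfl⟩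
    rw [Metric.mem_ball, Subtype.dist_eq]
    rcases hlt.1 with h | h
    · exact h
    · linarith

/-- The metric quotient `X/F` is any metric space `Q` together with a surjection
`π : X → Q` whose distance is given by the quotient pseudometric
`e_F(x, y) = min (dist x y) (infDist x F + infDist y F)`. -/
theorem quotient_metric_ultranormal {X : Type*} [MetricSpace X]
    (F : Set X) (hFne : F.Nonempty) (hFcl : IsClosed F)
    (hun : Ultranormal ↥(Fᶜ)) :
    ∀ (Q : Type*) [MetricSpace Q] (π : X → Q), Function.Surjective π →
      (∀ x y : X, dist (π x) (π y) =
        min (dist x y) (Metric.infDist x F + Metric.infDist y F)) →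
      Ultranormal Q := by
  intro Q _ π hsurj hπ
  obtain ⟨f, hf⟩ := hFne
  refine hun.of_isOpenEmbedding
    (isOpenEmbedding_domRestrict_compl_of_dist_eq ⟨f, hf⟩ hFcl hsurj hπ) (θ := π f) fun q hq => ?_
  obtain ⟨x, rfl⟩ := hsurj q
  refine ⟨⟨x, fun hx => hq (dist_eq_zero.1 ?_)⟩, rfl⟩
  rw [hπ, Metric.infDist_zero_of_mem hx, Metric.infDist_zero_of_mem hf, add_zero]
  exact min_eq_right dist_nonneg
end

section
/- Let (X, d) be a noncompact, σ-compact, locally compact metric space and F a noncompact closed subset of X. Suppose D is a metric on the one-point compactification X* = OnePoint X whose metric topology coincides with the topology of X* and with D(x, y) = d(x, y) for all x, y ∈ X. Then the metric quotient X/F (with respect to d) is isometric to the metric quotient X*/(F ∪ {∞}) (with respect to D); in particular, the metric quotient X/F is compact. -/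
/-- `d` is a metric on `Y` (as a bare function) whose metric topology coincides with the
given topology of `Y`. -/
def IsCompatMetric (Y : Type*) [TopologicalSpace Y] (d : Y → Y → ℝ) : Prop :=
  (∀ x y, 0 ≤ d x y) ∧ (∀ x y, d x y = d y x) ∧
  (∀ x y z, d x z ≤ d x y + d y z) ∧ (∀ x y, d x y = 0 ↔ x = y) ∧
  (∀ x : Y, ∀ s : Set Y, s ∈ nhds x ↔ ∃ ε > 0, {y : Y | d x y < ε} ⊆ s)

/-- Two surjections onto metric spaces that induce the same distance on their common source have
isometric targets. -/
lemma exists_equiv_dist_eq_of_surjective {Y Q Q' : Type*} [MetricSpace Q] [MetricSpace Q']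
    {g : Y → Q} {g' : Y → Q'} (hg : Function.Surjective g) (hg' : Function.Surjective g')
    (h : ∀ p q, dist (g p) (g q) = dist (g' p) (g' q)) :
    ∃ f : Q ≃ Q', ∀ a b, dist (f a) (f b) = dist a b := by
  let f : Q → Q' := fun a => g' (Function.surjInv hg a)
  have hf : ∀ a b, dist (f a) (f b) = dist a b := fun a b => by
    simp only [f, ← h, Function.surjInv_eq hg]
  have hfg : ∀ p, f (g p) = g' p := fun p => by
    rw [← dist_eq_zero, ← h, Function.surjInv_eq hg, dist_self]
  refine ⟨Equiv.ofBijective f ⟨(Isometry.of_dist_eq hf).injective, fun b => ?_⟩, hf⟩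
  obtain ⟨p, rfl⟩ := hg' b
  exact ⟨g p, hfg p⟩

/-- Every neighbourhood of `∞` meets a noncompact closed subset of the space. -/
lemma exists_coe_mem_of_mem_nhds_infty {X : Type*} [TopologicalSpace X] {F : Set X}
    (hFcl : IsClosed F) (hFnc : ¬ IsCompact F) {s : Set (OnePoint X)}
    (hs : s ∈ nhds OnePoint.infty) : ∃ a ∈ F, (a : OnePoint X) ∈ s := by
  by_contra! hcon
  obtain ⟨u, hus, huo, hu⟩ := mem_nhds_iff.1 hs
  refine hFnc (((OnePoint.isOpen_iff_of_mem hu).1 huo).2.of_isClosed_subset hFcl ?_)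
  exact fun a ha hau => hcon a ha (hus hau)

/-- A map from a topological space that is distance-nonincreasing for a compatible metric is
continuous. -/
lemma IsCompatMetric.continuous_of_dist_le {Y Q : Type*} [TopologicalSpace Y]
    [PseudoMetricSpace Q] {D : Y → Y → ℝ} (hD : IsCompatMetric Y D) {g : Y → Q}
    (hg : ∀ p q, dist (g p) (g q) ≤ D p q) : Continuous g := by
  refine continuous_iff_continuousAt.2 fun p => Metric.tendsto_nhds.2 fun ε hε => ?_
  refine (hD.2.2.2.2 p _).2 ⟨ε, hε, fun q hq => ?_⟩
  rw [Set.mem_ofPred_eq, dist_comm]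
  exact (hg p q).trans_lt hq

section OnePointMetric

variable {X : Type*} [MetricSpace X] {F : Set X} {D : OnePoint X → OnePoint X → ℝ}

/-- Points of a noncompact closed set come arbitrarily close to `∞`, so `infDist · F` is bounded by
the distance to `∞`. -/
lemma infDist_le_dist_infty (hFcl : IsClosed F) (hFnc : ¬ IsCompact F)
    (hD : IsCompatMetric (OnePoint X) D) (hDres : ∀ x y : X, D x y = dist x y) (x : X) :
    Metric.infDist x F ≤ D x OnePoint.infty := by
  refine le_of_forall_pos_le_add fun ε hε => ?_
  obtain ⟨a, ha, hlt⟩ := exists_coe_mem_of_mem_nhds_infty hFcl hFnc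
    ((hD.2.2.2.2 OnePoint.infty _).2 ⟨ε, hε, subset_rfl⟩)
  have htri := hD.2.2.1 x OnePoint.infty a
  rw [hDres] at htri
  have hlt' : D OnePoint.infty a < ε := hlt
  linarith [Metric.infDist_le_dist_of_mem (x := x) ha]

/-- The distance to `F ∪ {∞}` in the one-point compactification equals the distance to `F`. -/
lemma sInf_dist_insert_infty_coe (hFcl : IsClosed F) (hFnc : ¬ IsCompact F)
    (hD : IsCompatMetric (OnePoint X) D) (hDres : ∀ x y : X, D x y = dist x y) (x : X) :
    sInf {r : ℝ | ∃ a ∈ insert OnePoint.infty ((fun x : X => (x : OnePoint X)) '' F), D x a = r} =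
      Metric.infDist x F := by
  have hne : F.Nonempty := Set.nonempty_iff_ne_empty.2 fun h => hFnc (h ▸ isCompact_empty)
  apply le_antisymm
  · refine (Metric.le_infDist hne).2 fun y hy => csInf_le ⟨0, ?_⟩ ⟨y, ?_, hDres x y⟩
    · rintro _ ⟨a, -, rfl⟩
      exact hD.1 _ _
    · exact Or.inr ⟨y, hy, rfl⟩
  · refine le_csInf ⟨_, OnePoint.infty, Or.inl rfl, rfl⟩ ?_
    rintro _ ⟨a, rfl | ⟨y, hy, rfl⟩, rfl⟩
    · exact infDist_le_dist_infty hFcl hFnc hD hDres x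
    · exact (Metric.infDist_le_dist_of_mem hy).trans_eq (hDres x y).symm

end OnePointMetric

/-- The distance from a point to a set containing it is zero. -/
lemma IsCompatMetric.sInf_dist_eq_zero {Y : Type*} [TopologicalSpace Y] {D : Y → Y → ℝ}
    (hD : IsCompatMetric Y D) {s : Set Y} {p : Y} (hp : p ∈ s) :
    sInf {r : ℝ | ∃ a ∈ s, D p a = r} = 0 := by
  refine IsLeast.csInf_eq ⟨⟨p, hp, (hD.2.2.2.1 p p).2 rfl⟩, ?_⟩
  rintro _ ⟨a, -, rfl⟩
  exact hD.1 _ _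

theorem quotient_of_onePoint_isometric {X : Type*} [MetricSpace X]
    [SigmaCompactSpace X] [LocallyCompactSpace X]
    (hXnc : ¬ IsCompact (Set.univ : Set X))
    (F : Set X) (hFcl : IsClosed F) (hFnc : ¬ IsCompact F)
    (D : OnePoint X → OnePoint X → ℝ)
    (hD : IsCompatMetric (OnePoint X) D)
    (hDres : ∀ x y : X, D (x : OnePoint X) (y : OnePoint X) = dist x y) :
    let Fstar : Set (OnePoint X) :=
      insert OnePoint.infty ((fun x : X => (x : OnePoint X)) '' F)
    let e : X → X → ℝ := fun x y =>
      min (dist x y) (Metric.infDist x F + Metric.infDist y F)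
    let ρstar : OnePoint X → ℝ := fun p => sInf {r : ℝ | ∃ a ∈ Fstar, D p a = r}
    let estar : OnePoint X → OnePoint X → ℝ := fun p q => min (D p q) (ρstar p + ρstar q)
    ∀ (Q : Type*) [MetricSpace Q] (π : X → Q), Function.Surjective π →
      (∀ x y : X, dist (π x) (π y) = e x y) →
      (∀ (Q' : Type*) [MetricSpace Q'] (π' : OnePoint X → Q'), Function.Surjective π' →
        (∀ p q : OnePoint X, dist (π' p) (π' q) = estar p q) →
        ∃ f : Q ≃ Q', ∀ a b : Q, dist (f a) (f b) = dist a b) ∧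
      CompactSpace Q := by
  intro Fstar e ρstar estar Q _ π hπ hπe
  have hne : F.Nonempty := Set.nonempty_iff_ne_empty.2 fun h => hFnc (h ▸ isCompact_empty)
  obtain ⟨a₀, ha₀⟩ := hne
  have hρ : ∀ x : X, ρstar x = Metric.infDist x F :=
    sInf_dist_insert_infty_coe hFcl hFnc hD hDres
  have hρinf : ρstar OnePoint.infty = 0 := hD.sInf_dist_eq_zero (Set.mem_insert _ _)
  have ha₀F : Metric.infDist a₀ F = 0 := Metric.infDist_zero_of_mem ha₀
  let g : OnePoint X → Q := fun p => p.elim (π a₀) π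
  have hg : Function.Surjective g := fun q =>
    let ⟨x, hx⟩ := hπ q
    ⟨x, hx⟩
  have hinf : ∀ x : X, dist (π x) (π a₀) = estar x OnePoint.infty := fun x => by
    simp only [hπe, e, estar, hρ, hρinf, ha₀F, add_zero]
    rw [min_eq_right (Metric.infDist_le_dist_of_mem ha₀),
      min_eq_right (infDist_le_dist_infty hFcl hFnc hD hDres x)]
  have hge : ∀ p q, dist (g p) (g q) = estar p q := by
    intro p q
    induction p using OnePoint.rec with
    | infty =>
      induction q using OnePoint.rec with
      | infty =>
        simp only [g, OnePoint.elim_infty, dist_self, estar, hρinf, add_zero,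
          (hD.2.2.2.1 OnePoint.infty OnePoint.infty).2 rfl, min_self]
      | coe y =>
        change dist (π a₀) (π y) = _
        rw [dist_comm, hinf]
        simp only [estar, hD.2.1 y, add_comm (ρstar y)]
    | coe x =>
      induction q using OnePoint.rec with
      | infty => exact hinf x
      | coe y =>
        change dist (π x) (π y) = _
        simp only [hπe, e, estar, hρ, hDres]
  refine ⟨fun Q' _ π' hπ' hπe' => ?_, ?_⟩
  · exact exists_equiv_dist_eq_of_surjective hg hπ' fun p q => (hge p q).trans (hπe' p q).symm
  · have hcont : Continuous g :=
      hD.continuous_of_dist_le fun p q => (hge p q).trans_le (min_le_left _ _)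
    exact hg.compactSpace hcont
end

section
/- Let (X, d) be a metric space and F a nonempty closed subset of X such that the subspace X \ F is ultranormal. Then there exists a continuous retraction r : X → X onto F (i.e., r is continuous, r(X) ⊆ F, and r(a) = a for all a ∈ F) satisfying: (D) for every ε > 0 the image r({x ∈ X : infDist(x, F) ≥ ε}) is a closed and discrete subset of F; and (SR) for every sequence (x_i) in X with infDist(x_i, F) → 0 one has d(x_i, r(x_i)) → 0. -/
open Filter

open Topology

/-- In an ultranormal paracompact Hausdorff space, every open cover admits a locally constant
choice of a member of the cover containing a given point. -/
theorem Ultranormal.exists_isLocallyConstant_mem {Y ι : Type*} [TopologicalSpace Y] [T2Space Y]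
    [ParacompactSpace Y] (hY : Ultranormal Y) (u : ι → Set Y) (uo : ∀ i, IsOpen (u i))
    (uc : ⋃ i, u i = Set.univ) :
    ∃ s : Y → ι, IsLocallyConstant s ∧ ∀ y, y ∈ u (s y) := by
  obtain ⟨v, vo, vc, vf, vu⟩ := precise_refinement u uo uc
  obtain ⟨w, wc, wcl, wv⟩ := exists_iUnion_eq_closed_subset vo vf.point_finite vc
  choose C hC wC Cv using fun i => hY (w i) (v i)ᶜ (wcl i) (vo i).isClosed_compl
    (Set.disjoint_compl_right_iff_subset.2 (wv i))
  have hCv : ∀ i, C i ⊆ v i := fun i => Set.disjoint_compl_right_iff_subset.1 (Cv i)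
  have hne : ∀ y, {i | y ∈ C i}.Nonempty := fun y => by
    obtain ⟨i, hi⟩ := Set.mem_iUnion.1 (wc.symm ▸ Set.mem_univ y : y ∈ ⋃ i, w i)
    exact ⟨i, wC i hi⟩
  have hι : Y → Nonempty ι := fun y => ⟨(hne y).some⟩
  let pick : Y → Set ι → ι := fun y S => @Classical.epsilon ι (hι y) (· ∈ S)
  have hpick : ∀ y, pick y {i | y ∈ C i} ∈ {i | y ∈ C i} := fun y =>
    Classical.epsilon_spec (hne y)
  refine ⟨fun y => pick y {i | y ∈ C i}, ?_, fun y => vu _ (hCv _ (hpick y))⟩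
  rw [IsLocallyConstant.iff_eventually_eq]
  intro x
  obtain ⟨t, ht, hfin⟩ := (vf.subset hCv) x
  have key : ∀ᶠ y in 𝓝 x, ∀ i ∈ {i | (C i ∩ t).Nonempty}, (y ∈ C i ↔ x ∈ C i) := by
    rw [eventually_all_finite hfin]
    intro i _
    by_cases hx : x ∈ C i
    · filter_upwards [(hC i).isOpen.mem_nhds hx] with y hy using iff_of_true hy hx
    · filter_upwards [(hC i).compl.isOpen.mem_nhds hx] with y hy using iff_of_false hy hx
  filter_upwards [key, ht] with y hy hyt
  have : {i | y ∈ C i} = {i | x ∈ C i} := by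
    ext i
    exact ⟨fun h => (hy i ⟨y, h, hyt⟩).1 h, fun h => (hy i ⟨x, h, mem_of_mem_nhds ht⟩).2 h⟩
  simp only [this, pick]

/-- Every subset of a metric space contains a maximal `ε`-separated subset. -/
theorem exists_separated_net {X : Type*} [PseudoMetricSpace X] (F : Set X) {ε : ℝ} (hε : 0 < ε) :
    ∃ A ⊆ F, A.Pairwise (fun a b => ε ≤ dist a b) ∧ ∀ b ∈ F, ∃ a ∈ A, dist b a < ε := by
  obtain ⟨A, hA⟩ := zorn_subset {A : Set X | A ⊆ F ∧ A.Pairwise (fun a b => ε ≤ dist a b)}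
    (fun c hc hch => ⟨⋃₀ c, ⟨Set.sUnion_subset fun A hA => (hc hA).1,
      (Set.pairwise_sUnion hch.directedOn).2 fun A hA => (hc hA).2⟩,
      fun A hA => Set.subset_sUnion_of_mem hA⟩)
  refine ⟨A, hA.prop.1, hA.prop.2, fun b hb => ?_⟩
  by_contra! h
  have hins : insert b A ⊆ A := hA.le_of_ge
    ⟨Set.insert_subset hb hA.prop.1, hA.prop.2.insert fun a ha _ =>
      ⟨h a ha, dist_comm b a ▸ h a ha⟩⟩ (Set.subset_insert b A)
  have := h b (hins (Set.mem_insert b A))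
  rw [dist_self] at this
  exact this.not_gt hε

/-- A uniformly separated set has no accumulation points. -/
theorem eventually_nhdsNE_notMem_of_separated {X : Type*} [MetricSpace X] {A : Set X} {ε : ℝ}
    (hε : 0 < ε) (hA : A.Pairwise (fun a b => ε ≤ dist a b)) (x : X) :
    ∀ᶠ b in 𝓝[≠] x, b ∉ A := by
  rw [eventually_nhdsWithin_iff]
  by_cases h : ∃ b ∈ A, b ≠ x ∧ dist b x < ε / 2
  · obtain ⟨b, hbA, hbx, hb⟩ := h
    filter_upwards [Metric.ball_mem_nhds x (dist_pos.2 hbx)] with c hc _ hcA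
    rw [Metric.mem_ball] at hc
    have hne : b ≠ c := by
      rintro rfl
      exact lt_irrefl _ hc
    have := hA hbA hcA hne
    linarith [dist_triangle_right b c x]
  · push Not at h
    filter_upwards [Metric.ball_mem_nhds x (half_pos hε)] with c hc hcx hcA
    exact (h c hcA hcx).not_gt hc

theorem exists_retraction_D_SR {X : Type*} [MetricSpace X]
    (F : Set X) (hFne : F.Nonempty) (hFcl : IsClosed F)
    (hun : Ultranormal ↥(Fᶜ)) :
    ∃ r : X → X, Continuous r ∧ (∀ x, r x ∈ F) ∧ (∀ a ∈ F, r a = a) ∧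
      -- condition (D)
      (∀ ε : ℝ, 0 < ε →
        IsClosed {a : ↥F | (a : X) ∈ r '' {x : X | ε ≤ Metric.infDist x F}} ∧
        (∀ a ∈ r '' {x : X | ε ≤ Metric.infDist x F}, ∃ δ > 0,
          ∀ b ∈ r '' {x : X | ε ≤ Metric.infDist x F}, dist a b < δ → b = a)) ∧
      -- condition (SR)
      (∀ x : ℕ → X, Tendsto (fun i => Metric.infDist (x i) F) atTop (nhds 0) →
        Tendsto (fun i => dist (x i) (r (x i))) atTop (nhds 0)) := by
  choose A hAF hAsep hAnet using fun n : ℕ =>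
    exists_separated_net F (show (0 : ℝ) < (1 / 2) ^ n by positivity)
  let V : (Σ n, A n) → Set ↥(Fᶜ) := fun p =>
    {x | (1 / 2 : ℝ) ^ (p.1 + 1) < Metric.infDist (x : X) F ∧
      (p.1 = 0 ∨ dist (x : X) p.2 < 4 * (1 / 2) ^ p.1)}
  have Vo : ∀ p, IsOpen (V p) := fun p =>
    (isOpen_lt continuous_const ((Metric.continuous_infDist_pt F).comp continuous_subtype_val)).and
      (isOpen_const.union
        (isOpen_lt (continuous_subtype_val.dist continuous_const) continuous_const))
  have Vc : ⋃ p, V p = Set.univ := by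
    refine Set.eq_univ_of_forall fun x => Set.mem_iUnion.2 ?_
    have hpos : 0 < Metric.infDist (x : X) F := (hFcl.notMem_iff_infDist_pos hFne).1 x.2
    by_cases hx : Metric.infDist (x : X) F ≤ 1
    · obtain ⟨n, hn1, hn2⟩ := exists_nat_pow_near_of_lt_one hpos hx
        (show (0 : ℝ) < 1 / 2 by norm_num) (by norm_num)
      have hn : (0 : ℝ) < (1 / 2) ^ n := by positivity
      obtain ⟨b, hbF, hb⟩ := (Metric.infDist_lt_iff hFne).1
        (show Metric.infDist (x : X) F < 2 * (1 / 2) ^ n by linarith)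
      obtain ⟨a, haA, ha⟩ := hAnet n b hbF
      refine ⟨⟨n, a, haA⟩, hn1, Or.inr ?_⟩
      change dist (x : X) a < 4 * (1 / 2) ^ n
      linarith [dist_triangle (x : X) b a]
    · obtain ⟨a, haA, -⟩ := hAnet 0 _ hFne.some_mem
      refine ⟨⟨0, a, haA⟩, ?_, Or.inl rfl⟩
      change (1 / 2 : ℝ) ^ (0 + 1) < _
      norm_num
      linarith
  obtain ⟨s, hs, hsV⟩ := hun.exists_isLocallyConstant_mem V Vo Vc
  classical
  let r : X → X := fun x => if h : x ∈ F then x else (s ⟨x, h⟩).2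
  have hr1 : ∀ a ∈ F, r a = a := fun a ha => dif_pos ha
  have hr2 : ∀ x : ↥(Fᶜ), r x = (s x).2 := fun x => dif_neg x.2
  have hrF : ∀ x, r x ∈ F := fun x => by
    by_cases hx : x ∈ F
    · rwa [hr1 x hx]
    · rw [hr2 ⟨x, hx⟩]
      exact hAF _ (s ⟨x, hx⟩).2.2
  have hrd : ∀ x, Metric.infDist x F < 1 / 2 → dist x (r x) ≤ 8 * Metric.infDist x F := by
    intro x hx
    by_cases hxF : x ∈ F
    · rw [hr1 x hxF, dist_self, Metric.infDist_zero_of_mem hxF, mul_zero]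
    · rw [hr2 ⟨x, hxF⟩]
      obtain ⟨h1, h2 | h2⟩ := hsV ⟨x, hxF⟩
      · rw [h2] at h1
        norm_num at h1
        linarith
      · rw [pow_succ] at h1
        dsimp only at h1 h2
        linarith
  refine ⟨r, ?_, hrF, hr1, ?_, ?_⟩
  · rw [continuous_iff_continuousAt]
    intro x
    by_cases hx : x ∈ F
    · have hlim : Tendsto (fun y => 9 * dist y x) (𝓝 x) (𝓝 0) := by
        have : Continuous fun y => 9 * dist y x := by fun_prop
        simpa using this.tendsto x
      rw [ContinuousAt, hr1 x hx, tendsto_iff_dist_tendsto_zero]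
      refine squeeze_zero' (Eventually.of_forall fun _ => dist_nonneg) ?_ hlim
      filter_upwards [Metric.ball_mem_nhds x (show (0 : ℝ) < 1 / 2 by norm_num)] with y hy
      have hle := Metric.infDist_le_dist_of_mem (x := y) hx
      linarith [hrd y (hle.trans_lt hy), dist_triangle_left (r y) x y]
    · have hev := hs.eventually_eq ⟨x, hx⟩
      refine (hFcl.isOpen_compl.isOpenEmbedding_subtypeVal.continuousAt_iff
        (x := ⟨x, hx⟩)).1 (continuousAt_const.congr (f := fun _ => r x) ?_)
      filter_upwards [hev] with y hy
      rw [Function.comp_apply, hr2 y, hr2 ⟨x, hx⟩, hy]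
  · intro ε hε
    set T := r '' {x : X | ε ≤ Metric.infDist x F}
    obtain ⟨N, hN⟩ := exists_pow_lt_of_lt_one (show 0 < ε / 4 by positivity)
      (show (1 / 2 : ℝ) < 1 by norm_num)
    have hTA : ∀ b ∈ T, ∃ n ∈ Set.Iic N, b ∈ A n := by
      rintro _ ⟨x, hx, rfl⟩
      have hxF : x ∉ F := (hFcl.notMem_iff_infDist_pos hFne).2 (hε.trans_le hx)
      rw [hr2 ⟨x, hxF⟩]
      refine ⟨_, ?_, (s ⟨x, hxF⟩).2.2⟩
      obtain ⟨-, h2 | h2⟩ := hsV ⟨x, hxF⟩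
      · simp [h2]
      · by_contra hlt
        have hpow : (1 / 2 : ℝ) ^ (s ⟨x, hxF⟩).1 ≤ (1 / 2) ^ N :=
          pow_le_pow_of_le_one (by norm_num) (by norm_num) (not_le.1 hlt).le
        have hle := Metric.infDist_le_dist_of_mem (x := x) (hAF _ (s ⟨x, hxF⟩).2.2)
        have hx' : ε ≤ Metric.infDist x F := hx
        dsimp only at h2
        linarith
    have hacc : ∀ x, ∀ᶠ b in 𝓝[≠] x, b ∉ T := fun x => by
      have := (eventually_all_finite (Set.finite_Iic N)).2 fun n _ =>
        eventually_nhdsNE_notMem_of_separated (show (0 : ℝ) < (1 / 2) ^ n by positivity)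
          (hAsep n) x
      filter_upwards [this] with b hb hbT
      obtain ⟨n, hn, hbn⟩ := hTA b hbT
      exact hb n hn hbn
    simp only [eventually_nhdsWithin_iff] at hacc
    have hTcl : IsClosed T := by
      rw [← isOpen_compl_iff, isOpen_iff_mem_nhds]
      intro x hx
      filter_upwards [hacc x] with b hb hbT
      exact hb (fun h => hx (h ▸ hbT)) hbT
    refine ⟨hTcl.preimage continuous_subtype_val, fun a _ => ?_⟩
    obtain ⟨δ, hδ, h⟩ := Metric.eventually_nhds_iff.1 (hacc a)
    exact ⟨δ, hδ, fun b hb hab => by_contra fun hne => h (dist_comm a b ▸ hab) hne hb⟩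
  · intro x hx
    refine squeeze_zero' (Eventually.of_forall fun _ => dist_nonneg) ?_
      (by simpa using hx.const_mul 8)
    filter_upwards [hx.eventually_lt_const (show (0 : ℝ) < 1 / 2 by norm_num)] with i hi
    exact hrd _ hi
end

section
/- Let (X, d) be a metric space and F a nonempty closed subset of X such that the subspace X \ F is ultranormal. If r : X → X is a continuous retraction onto F satisfying conditions (D) and (SR), then r is a closed map: for every closed subset A of X, the image r(A) is closed. -/
open Filter

theorem retraction_D_SR_isClosedMap {X : Type*} [MetricSpace X]
    (F : Set X) (hFne : F.Nonempty) (hFcl : IsClosed F)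
    (hun : Ultranormal ↥(Fᶜ))
    (r : X → X) (hr_cont : Continuous r) (hr_mem : ∀ x, r x ∈ F)
    (hr_fix : ∀ a ∈ F, r a = a)
    -- condition (D)
    (hD : ∀ ε : ℝ, 0 < ε →
      IsClosed {a : ↥F | (a : X) ∈ r '' {x : X | ε ≤ Metric.infDist x F}} ∧
      (∀ a ∈ r '' {x : X | ε ≤ Metric.infDist x F}, ∃ δ > 0,
        ∀ b ∈ r '' {x : X | ε ≤ Metric.infDist x F}, dist a b < δ → b = a))
    -- condition (SR)
    (hSR : ∀ x : ℕ → X, Tendsto (fun i => Metric.infDist (x i) F) atTop (nhds 0) →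
      Tendsto (fun i => dist (x i) (r (x i))) atTop (nhds 0)) :
    IsClosedMap r := by
  intro A hA
  refine isClosed_of_closure_subset fun y hy => ?_
  obtain ⟨u, hu, hlim⟩ := mem_closure_iff_seq_limit.1 hy
  choose x hxA hxu using hu
  have hrx : Tendsto (fun i => r (x i)) atTop (nhds y) := by simpa only [hxu] using hlim
  have hyF : y ∈ F := hFcl.mem_of_tendsto hrx (Eventually.of_forall fun i => hr_mem _)
  by_cases h : Tendsto (fun i => Metric.infDist (x i) F) atTop (nhds 0)
  · have hxy : Tendsto x atTop (nhds y) :=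
      hrx.congr_dist (by simpa only [dist_comm] using hSR x h)
    exact ⟨y, hA.mem_of_tendsto hxy (Eventually.of_forall hxA), hr_fix y hyF⟩
  · obtain ⟨ε, hε, hfar⟩ : ∃ ε > 0, ∃ᶠ i in atTop, ε ≤ Metric.infDist (x i) F := by
      by_contra! hnear
      refine h (Metric.tendsto_nhds.2 fun ε hε => ?_)
      filter_upwards [hnear ε hε] with i hi
      rw [Real.dist_0_eq_abs, abs_of_nonneg Metric.infDist_nonneg]
      exact hi
    obtain ⟨hcl, hdisc⟩ := hD ε hε
    have hyS : y ∈ r '' {x : X | ε ≤ Metric.infDist x F} := by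
      have hmem := hcl.mem_of_frequently_of_tendsto
        (f := fun i => (⟨r (x i), hr_mem _⟩ : F)) (x := ⟨y, hyF⟩)
        (hfar.mono fun i hi => ⟨x i, hi, rfl⟩) (tendsto_subtype_rng.2 hrx)
      exact hmem
    obtain ⟨δ, hδ, hiso⟩ := hdisc y hyS
    obtain ⟨i, hi, hiδ⟩ := (hfar.and_eventually (Metric.tendsto_nhds.1 hrx δ hδ)).exists
    exact ⟨x i, hxA i, hiso _ ⟨x i, hi, rfl⟩ (by rwa [dist_comm])⟩
end

section
/- Let (X, d) be a metric space and F a nonempty closed subset of X such that the subspace X \ F is ultranormal. Let r : X → X be a continuous retraction onto F satisfying conditions (D) and (SR), let X/F be the metric quotient of X by F with projection π : X → X/F, and let θ ∈ X/F be the common image of the points of F. Define Φ : X → F × (X/F) by Φ(x) = (r(x), π(x)) (first coordinate regarded in the subspace F). Then: (P1) Φ(a) = (a, θ) for every a ∈ F; and (P2) Φ is a closed topological embedding, i.e., Φ is a homeomorphism of X onto its image and Φ(X) is a closed subset of F × (X/F). -/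
open Filter

/-- The sequential retraction condition (SR), restated for filters. -/
theorem tendsto_dist_retraction {X : Type*} [MetricSpace X] {F : Set X} {r : X → X}
    (hSR : ∀ x : ℕ → X, Tendsto (fun i => Metric.infDist (x i) F) atTop (nhds 0) →
      Tendsto (fun i => dist (x i) (r (x i))) atTop (nhds 0))
    {l : Filter X} (hl : Tendsto (fun x => Metric.infDist x F) l (nhds 0)) :
    Tendsto (fun x => dist x (r x)) l (nhds 0) := by
  have h : Tendsto (fun x => dist x (r x))
      (comap (fun x => Metric.infDist x F) (nhds 0)) (nhds 0) :=
    tendsto_of_seq_tendsto fun u hu => hSR u <|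
      (tendsto_comap (f := fun x => Metric.infDist x F)).comp hu
  exact h.mono_left hl.le_comap

/-- Away from `F`, convergence in the metric quotient is convergence in `X`. -/
theorem le_nhds_of_tendsto_quotient {X Q : Type*} [MetricSpace X] [MetricSpace Q] {F : Set X}
    {π : X → Q} (hπ_dist : ∀ x y : X, dist (π x) (π y) =
      min (dist x y) (Metric.infDist x F + Metric.infDist y F))
    {y : X} (hy : 0 < Metric.infDist y F) {l : Filter X} (hl : Tendsto π l (nhds (π y))) :
    l ≤ nhds y := by
  refine Metric.tendsto_nhds.2 fun ε hε => ?_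
  filter_upwards [Metric.tendsto_nhds.1 hl (min ε (Metric.infDist y F)) (lt_min hε hy)] with x hx
  rw [hπ_dist, lt_min_iff] at hx
  have hx0 : 0 ≤ Metric.infDist x F := Metric.infDist_nonneg
  rcases min_choice (dist x y) (Metric.infDist x F + Metric.infDist y F) with h | h <;>
    rw [h] at hx
  · exact hx.1
  · linarith [hx.2]

/-- Convergence in the metric quotient to the image of a point of `F` means that the distance
to `F` tends to zero. -/
theorem tendsto_infDist_of_tendsto_quotient {X Q : Type*} [MetricSpace X] [MetricSpace Q]
    {F : Set X} {π : X → Q} (hπ_dist : ∀ x y : X, dist (π x) (π y) =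
      min (dist x y) (Metric.infDist x F + Metric.infDist y F))
    {y : X} (hy : y ∈ F) {l : Filter X} (hl : Tendsto π l (nhds (π y))) :
    Tendsto (fun x => Metric.infDist x F) l (nhds 0) := by
  refine (tendsto_iff_dist_tendsto_zero.1 hl).congr fun x => ?_
  rw [hπ_dist, Metric.infDist_zero_of_mem hy, add_zero,
    min_eq_right (Metric.infDist_le_dist_of_mem hy)]

theorem embedding_into_product {X : Type*} [MetricSpace X]
    (F : Set X) (hFne : F.Nonempty) (hFcl : IsClosed F)
    (hun : Ultranormal ↥(Fᶜ))
    (r : X → X) (hr_cont : Continuous r) (hr_mem : ∀ x, r x ∈ F)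
    (hr_fix : ∀ a ∈ F, r a = a)
    -- condition (D)
    (hD : ∀ ε : ℝ, 0 < ε →
      IsClosed {a : ↥F | (a : X) ∈ r '' {x : X | ε ≤ Metric.infDist x F}} ∧
      (∀ a ∈ r '' {x : X | ε ≤ Metric.infDist x F}, ∃ δ > 0,
        ∀ b ∈ r '' {x : X | ε ≤ Metric.infDist x F}, dist a b < δ → b = a))
    -- condition (SR)
    (hSR : ∀ x : ℕ → X, Tendsto (fun i => Metric.infDist (x i) F) atTop (nhds 0) →
      Tendsto (fun i => dist (x i) (r (x i))) atTop (nhds 0))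
    -- the metric quotient X/F, given by a surjection π whose distance is the
    -- quotient pseudometric e_F
    (Q : Type*) [MetricSpace Q] (π : X → Q) (hπ_surj : Function.Surjective π)
    (hπ_dist : ∀ x y : X, dist (π x) (π y) =
      min (dist x y) (Metric.infDist x F + Metric.infDist y F)) :
    let Φ : X → ↥F × Q := fun x => (⟨r x, hr_mem x⟩, π x)
    -- (P1): Φ a = (a, θ), where θ = π b is the common image of the points of F
    (∀ a : X, ∀ ha : a ∈ F, ∀ b ∈ F, Φ a = (⟨a, ha⟩, π b)) ∧
    -- (P2): Φ is a closed topological embedding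
    Topology.IsEmbedding Φ ∧ IsClosed (Set.range Φ) := by
  intro Φ
  have hπF : ∀ a ∈ F, ∀ b ∈ F, π a = π b := fun a ha b hb => by
    rw [← dist_eq_zero, hπ_dist, Metric.infDist_zero_of_mem ha, Metric.infDist_zero_of_mem hb,
      add_zero, min_eq_right dist_nonneg]
  have hP1 : ∀ a : X, ∀ ha : a ∈ F, ∀ b ∈ F, Φ a = (⟨a, ha⟩, π b) := fun a ha b hb =>
    Prod.ext (Subtype.ext (hr_fix a ha)) (hπF a ha b hb)
  have hπ_cont : Continuous π := by
    refine (LipschitzWith.of_dist_le_mul (K := 1) fun x y => ?_).continuous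
    rw [hπ_dist, NNReal.coe_one, one_mul]
    exact min_le_left _ _
  have hΦ_cont : Continuous Φ := (hr_cont.subtype_mk hr_mem).prodMk hπ_cont
  have hlim : ∀ (l : Filter X) [l.NeBot] (p : ↥F × Q), Tendsto Φ l (nhds p) →
      ∃ z, Φ z = p ∧ l ≤ nhds z := by
    rintro l _ ⟨a, q⟩ hl
    obtain ⟨y, rfl⟩ := hπ_surj q
    obtain ⟨hl₁, hl₂⟩ := Prod.tendsto_iff _ _ |>.1 hl
    by_cases hy : y ∈ F
    · refine ⟨a, hP1 a a.2 y hy, ?_⟩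
      have hd := tendsto_dist_retraction hSR (tendsto_infDist_of_tendsto_quotient hπ_dist hy hl₂)
      have hra : Tendsto r l (nhds (a : X)) := (continuous_subtype_val.tendsto a).comp hl₁
      exact (tendsto_iff_of_dist hd).2 hra
    · have hly : l ≤ nhds y := le_nhds_of_tendsto_quotient hπ_dist
        ((hFcl.notMem_iff_infDist_pos hFne).1 hy) hl₂
      exact ⟨y, tendsto_nhds_unique ((hΦ_cont.tendsto y).mono_left hly) hl, hly⟩
  have hinj : Function.Injective Φ := fun x y hxy => by
    obtain ⟨z, -, hz⟩ := hlim (pure x ⊔ pure y) (Φ x)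
      (Tendsto.sup (tendsto_pure_nhds Φ x) (hxy ▸ tendsto_pure_nhds Φ y))
    exact (pure_le_nhds_iff.1 (le_sup_left.trans hz)).trans
      (pure_le_nhds_iff.1 (le_sup_right.trans hz)).symm
  have hproper : IsProperMap Φ :=
    isProperMap_iff_ultrafilter.2 ⟨hΦ_cont, fun 𝒰 p h => hlim 𝒰 p h⟩
  have hemb : Topology.IsClosedEmbedding Φ :=
    .of_continuous_injective_isClosedMap hΦ_cont hinj hproper.isClosedMap
  exact ⟨hP1, hemb.isEmbedding, hemb.isClosed_range⟩
end

section
/- Let X be a metrizable topological space and F a nonempty closed subset of X such that the subspace X \ F is ultranormal. Then there exists a map Ξ : Met(F) → Met(X) such that for all d, e ∈ Met(F): (1) Ξ(d) restricted to F × F equals d; (2) sup_{x,y ∈ X} |Ξ(d)(x, y) − Ξ(e)(x, y)| = sup_{a,b ∈ F} |d(a, b) − e(a, b)| as elements of [0, ∞] (Ξ is an isometry for the sup-distance); (3) if d(a, b) ≤ e(a, b) for all a, b ∈ F, then Ξ(d)(x, y) ≤ Ξ(e)(x, y) for all x, y ∈ X; and (4) Ξ(max(d, e)) = max(Ξ(d),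 Ξ(e)), where max is taken pointwise. -/
open Topology Metric

/-- In an ultranormal paracompact Hausdorff space, every open cover admits a locally constant
selection of a member of the cover containing each point. -/
theorem Ultranormal.exists_isLocallyConstant_selection {Y ι : Type*} [TopologicalSpace Y]
    [ParacompactSpace Y] [T2Space Y] (hY : Ultranormal Y) (u : ι → Set Y)
    (huo : ∀ i, IsOpen (u i)) (hu : ⋃ i, u i = Set.univ) :
    ∃ g : Y → ι, IsLocallyConstant g ∧ ∀ y, y ∈ u (g y) := by
  obtain ⟨v, hvo, hv, hvf, hvu⟩ := precise_refinement u huo hu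
  obtain ⟨c, hc, hcc, hcv⟩ :=
    exists_iUnion_eq_closed_subset hvo hvf.point_finite hv
  have hK : ∀ i, ∃ K : Set Y, IsClopen K ∧ c i ⊆ K ∧ K ⊆ v i := fun i => by
    obtain ⟨K, hK, h₁, h₂⟩ := hY (c i) (v i)ᶜ (hcc i) (hvo i).isClosed_compl
      (Set.disjoint_compl_right_iff_subset.2 (hcv i))
    exact ⟨K, hK, h₁, Set.disjoint_compl_right_iff_subset.1 h₂⟩
  choose K hKc hcK hKv using hK
  have hKf : LocallyFinite K := hvf.subset hKv
  have hne : ∀ y, {i | y ∈ K i}.Nonempty := fun y => by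
    obtain ⟨i, hi⟩ := Set.mem_iUnion.1 (hc ▸ Set.mem_univ y : y ∈ ⋃ i, c i)
    exact ⟨i, hcK i hi⟩
  have wf : WellFounded (WellOrderingRel : ι → ι → Prop) := WellOrderingRel.isWellOrder.wf
  have hmem : ∀ y, y ∈ K (wf.min _ (hne y)) := fun y => wf.min_mem _ (hne y)
  refine ⟨fun y => wf.min _ (hne y), ?_, fun y => hvu _ (hKv _ (hmem y))⟩
  rw [IsLocallyConstant.iff_exists_open]
  intro y
  set i := wf.min _ (hne y) with hi
  refine ⟨K i ∩ (⋃ j : {j // WellOrderingRel j i}, K j)ᶜ,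
    (hKc i).isOpen.inter (IsClosed.isOpen_compl (self := ?_)), ⟨hmem y, ?_⟩, ?_⟩
  · exact (hKf.comp_injective Subtype.val_injective).isClosed_iUnion fun j => (hKc j).isClosed
  · rw [Set.mem_compl_iff, Set.mem_iUnion]
    rintro ⟨⟨j, hj⟩, hyj⟩
    exact wf.not_lt_min {i | y ∈ K i} hyj hj
  · rintro z ⟨hz, hz'⟩
    rw [Set.mem_compl_iff, Set.mem_iUnion] at hz'
    rcases trichotomous_of WellOrderingRel (wf.min _ (hne z)) i with h | h | h
    · exact (hz' ⟨⟨_, h⟩, hmem z⟩).elim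
    · exact h
    · exact (wf.not_lt_min {i | z ∈ K i} hz h).elim

/-- A nonempty closed subset with ultranormal complement is a retract, by a retraction moving
each point at most twice its distance to the subset. -/
theorem exists_retraction_dist_le {X : Type*} [MetricSpace X] {F : Set X} (hFne : F.Nonempty)
    (hFcl : IsClosed F) (hun : Ultranormal ↥(Fᶜ)) :
    ∃ r : X → F, Continuous r ∧ (∀ a : F, r a = a) ∧
      ∀ x : X, dist x (r x) ≤ 2 * infDist x F := by
  classical
  obtain ⟨g, hg, hgu⟩ := hun.exists_isLocallyConstant_selection
    (fun a : F => {y : ↥(Fᶜ) | dist (y : X) a < 2 * infDist (y : X) F})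
    (fun a => isOpen_lt (by fun_prop)
      (continuous_const.mul ((continuous_infDist_pt F).comp continuous_subtype_val)))
    (Set.eq_univ_of_forall fun y => by
      have hpos := (hFcl.notMem_iff_infDist_pos hFne).1 y.2
      obtain ⟨a, ha, hya⟩ := (infDist_lt_iff (r := 2 * infDist (y : X) F) hFne).1 (by linarith)
      exact Set.mem_iUnion.2 ⟨⟨a, ha⟩, hya⟩)
  let r : X → F := fun x => if h : x ∈ F then ⟨x, h⟩ else g ⟨x, h⟩
  have hrF : ∀ a : F, r a = a := fun a => dif_pos a.2
  have hrc : ∀ y : ↥(Fᶜ), r y = g y := fun y => dif_neg y.2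
  have hle : ∀ x : X, dist x (r x) ≤ 2 * infDist x F := fun x => by
    by_cases h : x ∈ F
    · rw [hrF ⟨x, h⟩, infDist_zero_of_mem h]
      simp
    · rw [hrc ⟨x, h⟩]
      exact (hgu ⟨x, h⟩).le
  refine ⟨r, continuous_iff_continuousAt.2 fun x => ?_, hrF, hle⟩
  by_cases h : x ∈ F
  · rw [Metric.continuousAt_iff]
    intro ε hε
    refine ⟨ε / 3, by positivity, fun {y} hy => ?_⟩
    have h₁ := dist_triangle_left (r y : X) x y
    have h₂ := hle y
    have h₃ := infDist_le_dist_of_mem (x := y) h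
    rw [hrF ⟨x, h⟩, Subtype.dist_eq]
    linarith
  · have hcomp : Continuous (r ∘ ((↑) : ↥(Fᶜ) → X)) := by
      rw [show r ∘ ((↑) : ↥(Fᶜ) → X) = g from funext hrc]
      exact hg.continuous
    exact (hFcl.isOpen_compl.isOpenEmbedding_subtypeVal.continuousAt_iff
      (x := ⟨x, h⟩)).1 hcomp.continuousAt

/-- The pseudometric obtained by collapsing `F` to a point. -/
noncomputable def collapseDist {X : Type*} [MetricSpace X] (F : Set X) (x y : X) : ℝ :=
  min (dist x y) (infDist x F + infDist y F)

section collapseDist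

variable {X : Type*} [MetricSpace X] (F : Set X)

theorem collapseDist_nonneg (x y : X) : 0 ≤ collapseDist F x y :=
  le_min dist_nonneg (add_nonneg infDist_nonneg infDist_nonneg)

theorem collapseDist_self (x : X) : collapseDist F x x = 0 :=
  le_antisymm ((min_le_left _ _).trans (dist_self x).le) (collapseDist_nonneg F x x)

theorem collapseDist_comm (x y : X) : collapseDist F x y = collapseDist F y x := by
  rw [collapseDist, collapseDist, dist_comm, add_comm]

theorem collapseDist_triangle (x y z : X) :
    collapseDist F x z ≤ collapseDist F x y + collapseDist F y z := by
  have h₁ := dist_triangle x y z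
  have h₂ := infDist_le_infDist_add_dist (s := F) (x := x) (y := y)
  have h₃ := infDist_le_infDist_add_dist (s := F) (x := z) (y := y)
  rw [dist_comm z y] at h₃
  have h₄ := infDist_nonneg (s := F) (x := y)
  unfold collapseDist
  rcases min_cases (dist x y) (infDist x F + infDist y F) with h | h <;>
  rcases min_cases (dist y z) (infDist y F + infDist z F) with h' | h' <;>
  rw [h.1, h'.1] <;>
  first
  | exact (min_le_left _ _).trans (by linarith)
  | exact (min_le_right _ _).trans (by linarith)

variable {F}

theorem collapseDist_of_mem_left {x : X} (hx : x ∈ F) (y : X) :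
    collapseDist F x y = infDist y F := by
  rw [collapseDist, infDist_zero_of_mem hx, zero_add, dist_comm]
  exact min_eq_right (infDist_le_dist_of_mem hx)

theorem dist_lt_of_collapseDist_lt {x y : X} {ε : ℝ} (h : collapseDist F x y < ε)
    (hε : ε ≤ infDist x F) : dist x y < ε := by
  rcases min_lt_iff.1 h with h | h
  · exact h
  · linarith [infDist_nonneg (s := F) (x := y)]

end collapseDist

/-- The extension of `d` from `F` along a retraction `r`. -/
noncomputable def retractExtension {X : Type*} [MetricSpace X] {F : Set X} (r : X → F)
    (d : F → F → ℝ) (x y : X) : ℝ :=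
  max (d (r x) (r y)) (collapseDist F x y)

section retractExtension

variable {X : Type*} [MetricSpace X] {F : Set X} {r : X → F} {d : F → F → ℝ}

theorem retractExtension_lt_iff {x y : X} {ε : ℝ} :
    retractExtension r d x y < ε ↔ d (r x) (r y) < ε ∧ collapseDist F x y < ε :=
  max_lt_iff

theorem retractExtension_coe (hrF : ∀ a : F, r a = a) (hd : IsCompatMetric F d) (a b : F) :
    retractExtension r d a b = d a b := by
  rw [retractExtension, collapseDist_of_mem_left a.2, infDist_zero_of_mem b.2, hrF, hrF]
  exact max_eq_left (hd.1 a b)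

theorem setOf_retractExtension_lt_mem_nhds (hr : Continuous r) (hd : IsCompatMetric F d)
    (x : X) {ε : ℝ} (hε : 0 < ε) : {y | retractExtension r d x y < ε} ∈ 𝓝 x := by
  have h₁ : {b | d (r x) b < ε} ∈ 𝓝 (r x) := (hd.2.2.2.2 _ _).2 ⟨ε, hε, subset_rfl⟩
  filter_upwards [hr.continuousAt h₁, ball_mem_nhds x hε] with y hy hy'
  exact max_lt hy ((min_le_left _ _).trans_lt (by rwa [dist_comm]))

theorem exists_setOf_retractExtension_lt_subset (hFne : F.Nonempty) (hFcl : IsClosed F)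
    (hrF : ∀ a : F, r a = a) (hle : ∀ x : X, dist x (r x) ≤ 2 * infDist x F)
    (hd : IsCompatMetric F d) {x : X} {s : Set X} (hs : s ∈ 𝓝 x) :
    ∃ ε > 0, {y | retractExtension r d x y < ε} ⊆ s := by
  obtain ⟨δ, hδ, hδs⟩ := Metric.mem_nhds_iff.1 hs
  by_cases hx : x ∈ F
  · obtain ⟨η, hη, hηs⟩ := (hd.2.2.2.2 ⟨x, hx⟩ _).1
      (ball_mem_nhds (⟨x, hx⟩ : F) (half_pos hδ))
    refine ⟨min η (δ / 4), lt_min hη (by positivity), fun y hy => hδs ?_⟩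
    obtain ⟨hy₁, hy₂⟩ := retractExtension_lt_iff.1 hy
    rw [hrF ⟨x, hx⟩] at hy₁
    rw [collapseDist_of_mem_left hx] at hy₂
    have h₁ : dist (r y : X) x < δ / 2 := hηs (hy₁.trans_le (min_le_left _ _))
    have h₂ := hy₂.trans_le (min_le_right _ _)
    have h₃ := hle y
    have h₄ := dist_triangle y (r y : X) x
    exact mem_ball.2 (by linarith)
  · refine ⟨min δ (infDist x F), lt_min hδ ((hFcl.notMem_iff_infDist_pos hFne).1 hx),
      fun y hy => hδs ?_⟩
    have h := dist_lt_of_collapseDist_lt (retractExtension_lt_iff.1 hy).2 (min_le_right _ _)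
    exact mem_ball'.2 (h.trans_le (min_le_left _ _))

theorem isCompatMetric_retractExtension (hFne : F.Nonempty) (hFcl : IsClosed F)
    (hr : Continuous r) (hrF : ∀ a : F, r a = a) (hle : ∀ x : X, dist x (r x) ≤ 2 * infDist x F)
    (hd : IsCompatMetric F d) : IsCompatMetric X (retractExtension r d) := by
  refine ⟨fun x y => (collapseDist_nonneg F x y).trans (le_max_right _ _), fun x y => ?_,
    fun x y z => ?_, fun x y => ⟨fun h => ?_, ?_⟩, fun x s =>
    ⟨exists_setOf_retractExtension_lt_subset hFne hFcl hrF hle hd, ?_⟩⟩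
  · rw [retractExtension, retractExtension, hd.2.1, collapseDist_comm]
  · exact max_le
      ((hd.2.2.1 _ (r y) _).trans (add_le_add (le_max_left _ _) (le_max_left _ _)))
      ((collapseDist_triangle F x y z).trans (add_le_add (le_max_right _ _) (le_max_right _ _)))
  · by_contra hxy
    obtain ⟨ε, hε, hsub⟩ := exists_setOf_retractExtension_lt_subset hFne hFcl hrF hle hd
      (isOpen_compl_singleton.mem_nhds hxy : {y}ᶜ ∈ 𝓝 x)
    exact hsub (h.trans_lt hε : retractExtension r d x y < ε) rfl
  · rintro rfl
    rw [retractExtension, collapseDist_self, (hd.2.2.2.1 _ _).2 rfl, max_self]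
  · rintro ⟨ε, hε, hsub⟩
    exact Filter.mem_of_superset (setOf_retractExtension_lt_mem_nhds hr hd x hε) hsub

end retractExtension

theorem exists_metric_extensor {X : Type*} [TopologicalSpace X]
    [TopologicalSpace.MetrizableSpace X]
    (F : Set X) (hFne : F.Nonempty) (hFcl : IsClosed F)
    (hun : Ultranormal ↥(Fᶜ)) :
    ∃ Ξ : (↥F → ↥F → ℝ) → (X → X → ℝ),
      (∀ d, IsCompatMetric ↥F d → IsCompatMetric X (Ξ d)) ∧
      -- (1) extension
      (∀ d, IsCompatMetric ↥F d → ∀ a b : ↥F, Ξ d (a : X) (b : X) = d a b) ∧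
      -- (2) sup-distance isometry (in [0, ∞])
      (∀ d e, IsCompatMetric ↥F d → IsCompatMetric ↥F e →
        (⨆ x : X, ⨆ y : X, ENNReal.ofReal |Ξ d x y - Ξ e x y|) =
          (⨆ a : ↥F, ⨆ b : ↥F, ENNReal.ofReal |d a b - e a b|)) ∧
      -- (3) monotonicity
      (∀ d e, IsCompatMetric ↥F d → IsCompatMetric ↥F e →
        (∀ a b : ↥F, d a b ≤ e a b) → ∀ x y : X, Ξ d x y ≤ Ξ e x y) ∧
      -- (4) compatibility with pointwise maxima
      (∀ d e, IsCompatMetric ↥F d → IsCompatMetric ↥F e →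
        ∀ x y : X, Ξ (fun a b => max (d a b) (e a b)) x y = max (Ξ d x y) (Ξ e x y)) := by
  let _ := TopologicalSpace.metrizableSpaceMetric X
  obtain ⟨r, hr, hrF, hle⟩ := exists_retraction_dist_le hFne hFcl hun
  refine ⟨retractExtension r,
    fun d hd => isCompatMetric_retractExtension hFne hFcl hr hrF hle hd,
    fun d hd => retractExtension_coe hrF hd, fun d e hd he => le_antisymm ?_ ?_,
    fun d e _ _ h x y => max_le_max_right _ (h _ _),
    fun d e _ _ x y => sup_sup_distrib_right _ _ _⟩
  · refine iSup₂_le fun x y => le_trans (ENNReal.ofReal_le_ofReal ?_)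
      (le_iSup₂ (f := fun a b : F => ENNReal.ofReal |d a b - e a b|) (r x) (r y))
    exact abs_sup_sub_sup_le_abs _ _ _
  · refine iSup₂_le fun a b => ?_
    rw [← retractExtension_coe hrF hd, ← retractExtension_coe hrF he]
    exact le_iSup₂ (f := fun x y : X =>
      ENNReal.ofReal |retractExtension r d x y - retractExtension r e x y|) (a : X) (b : X)
end

section
/- Let X be a topological space admitting a compatible ultrametric (i.e., some member of Met(X) is an ultrametric), let F be a nonempty closed subset of X, and let S be a characteristic subset of [0, ∞). Then there exists a map Σ : Met(F) → Met(X) such that for all d, e ∈ Met(F): (1) Σ(d) restricted to F × F equals d; (2) u^S_X(Σ(d), Σ(e)) = u^S_F(d, e); (3) if d(a, b) ≤ e(a, b) for all a, b ∈ F then Σ(d)(x, y) ≤ Σ(e)(x, y) for all x, y ∈ X; (4) Σ(max(d, e)) = max(Σ(d), Σ(e)) pointwise; and (5) if d is an ultrametric taking all its values in S, then Σ(d) is an ultrametric on X taking all its values in S. -/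
/-- A metric (as a bare function) is an ultrametric if it satisfies the strong triangle
inequality. -/
def IsUltrametricFun {Y : Type*} (d : Y → Y → ℝ) : Prop :=
  ∀ x y z : Y, d x z ≤ max (d x y) (d y z)

/-- A subset `S` of `[0, ∞)` is characteristic if `0 ∈ S` and `S` contains arbitrarily
small positive numbers. -/
def CharacteristicSet (S : Set ℝ) : Prop :=
  S ⊆ Set.Ici 0 ∧ (0 : ℝ) ∈ S ∧ ∀ t : ℝ, 0 < t → ∃ s ∈ S, 0 < s ∧ s ≤ t

/-- The ultrametric distance `u^S_Y(d, e)` between two metrics: the infimum in `[0, ∞]`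
of the positive `ε ∈ S` with `d ≤ max e ε` and `e ≤ max d ε` pointwise. -/
noncomputable def uDist {Y : Type*} (S : Set ℝ) (d e : Y → Y → ℝ) : ENNReal :=
  sInf (ENNReal.ofReal '' {ε : ℝ | ε ∈ S ∧ 0 < ε ∧
    ∀ x y : Y, d x y ≤ max (e x y) ε ∧ e x y ≤ max (d x y) ε})

theorem IsCompatMetric.self_eq_zero {Y : Type*} [TopologicalSpace Y] {d : Y → Y → ℝ}
    (hd : IsCompatMetric Y d) (x : Y) : d x x = 0 :=
  (hd.2.2.2.1 x x).2 rfl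

theorem IsCompatMetric.subtype {Y : Type*} [TopologicalSpace Y] {d : Y → Y → ℝ}
    (hd : IsCompatMetric Y d) (F : Set Y) : IsCompatMetric F (fun a b : F => d a b) := by
  obtain ⟨h0, hsymm, htri, heq, hnhds⟩ := hd
  refine ⟨fun _ _ => h0 _ _, fun _ _ => hsymm _ _, fun _ _ _ => htri _ _ _,
    fun _ _ => (heq _ _).trans Subtype.ext_iff.symm, fun x s => ?_⟩
  rw [mem_nhds_subtype]
  constructor
  · rintro ⟨t, ht, hts⟩
    obtain ⟨ε, hε, h⟩ := (hnhds _ _).1 ht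
    exact ⟨ε, hε, fun y hy => hts (h hy)⟩
  · rintro ⟨ε, hε, h⟩
    exact ⟨{y | d x y < ε}, (hnhds _ _).2 ⟨ε, hε, subset_rfl⟩, fun y hy => h hy⟩

/-- A characteristic set contains an antitone sequence of positive numbers tending to zero. -/
theorem CharacteristicSet.exists_antitone_seq {S : Set ℝ} (hS : CharacteristicSet S) :
    ∃ s : ℕ → ℝ, (∀ n, s n ∈ S) ∧ (∀ n, 0 < s n) ∧ Antitone s ∧
      ∀ ε : ℝ, 0 < ε → ∃ n, s n < ε := by
  choose! f hfS hfpos hfle using hS.2.2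
  let s : ℕ → ℝ := fun n => Nat.rec (f 1) (fun k t => f (min t (1 / ((k : ℝ) + 1)))) n
  have hsucc : ∀ n : ℕ, s (n + 1) = f (min (s n) (1 / ((n : ℝ) + 1))) := fun _ => rfl
  have hpos : ∀ n, 0 < s n := by
    intro n
    induction n with
    | zero => exact hfpos _ one_pos
    | succ n ih => rw [hsucc]; exact hfpos _ (lt_min ih (by positivity))
  have hmin : ∀ n : ℕ, 0 < min (s n) (1 / ((n : ℝ) + 1)) :=
    fun n => lt_min (hpos n) (by positivity)
  refine ⟨s, ?_, hpos, antitone_nat_of_succ_le fun n => ?_, fun ε hε => ?_⟩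
  · rintro (_ | n)
    · exact hfS _ one_pos
    · rw [hsucc]; exact hfS _ (hmin n)
  · rw [hsucc]; exact (hfle _ (hmin n)).trans (min_le_left _ _)
  · obtain ⟨n, hn⟩ := exists_nat_one_div_lt hε
    refine ⟨n + 1, ?_⟩
    rw [hsucc]
    exact ((hfle _ (hmin n)).trans (min_le_right _ _)).trans_lt hn

/-- An ultrametrizable space has a compatible ultrametric with values in a given characteristic
set for which every point has a nearest point in each nonempty closed set. -/
theorem exists_ultrametric_forall_exists_nearest {X : Type*} [TopologicalSpace X]
    (hu : ∃ u : X → X → ℝ, IsCompatMetric X u ∧ IsUltrametricFun u)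
    {S : Set ℝ} (hS : CharacteristicSet S) :
    ∃ w : X → X → ℝ, IsCompatMetric X w ∧ IsUltrametricFun w ∧ (∀ x y, w x y ∈ S) ∧
      ∀ F : Set X, F.Nonempty → IsClosed F → ∀ x, ∃ a ∈ F, ∀ b ∈ F, w x a ≤ w x b := by
  obtain ⟨u, ⟨h0, hsymm, -, heq, hnhds⟩, hult⟩ := hu
  obtain ⟨s, hsS, hspos, hsanti, hslim⟩ := hS.exists_antitone_seq
  let φ : ℝ → ℝ := fun t => if t = 0 then 0 else s ⌊1 / t⌋₊
  have hφ0 : φ 0 = 0 := if_pos rfl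
  have hφne : ∀ t, t ≠ 0 → φ t = s ⌊1 / t⌋₊ := fun t ht => if_neg ht
  have hφnonneg : ∀ t, 0 ≤ φ t := by
    intro t
    by_cases ht : t = 0
    · rw [ht, hφ0]
    · rw [hφne t ht]; exact (hspos _).le
  have hφS : ∀ t, φ t ∈ S := by
    intro t
    by_cases ht : t = 0
    · rw [ht, hφ0]; exact hS.2.1
    · rw [hφne t ht]; exact hsS _
  have hφeq : ∀ t, φ t = 0 ↔ t = 0 := by
    refine fun t => ⟨fun h => ?_, fun h => h ▸ hφ0⟩
    by_contra ht
    rw [hφne t ht] at h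
    exact (hspos _).ne' h
  have hφmono : ∀ t t', 0 ≤ t → t ≤ t' → φ t ≤ φ t' := by
    intro t t' ht htt'
    rcases ht.eq_or_lt with rfl | ht
    · rw [hφ0]; exact hφnonneg _
    · rw [hφne t ht.ne', hφne t' (ht.trans_le htt').ne']
      exact hsanti (Nat.floor_le_floor (one_div_le_one_div_of_le ht htt'))
  have hφsmall : ∀ ε, 0 < ε → ∃ η, 0 < η ∧ ∀ t, 0 ≤ t → t < η → φ t < ε := by
    intro ε hε
    obtain ⟨n, hn⟩ := hslim ε hε
    refine ⟨1 / ((n : ℝ) + 1), by positivity, fun t ht htη => ?_⟩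
    rcases ht.eq_or_lt with rfl | ht
    · rwa [hφ0]
    · rw [hφne t ht.ne']
      refine (hsanti (Nat.le_floor ?_)).trans_lt hn
      rw [lt_one_div ht (by positivity)] at htη
      linarith
  have hwult : IsUltrametricFun fun x y => φ (u x y) := by
    intro x y z
    rcases le_max_iff.1 (hult x y z) with h | h
    · exact le_max_of_le_left (hφmono _ _ (h0 _ _) h)
    · exact le_max_of_le_right (hφmono _ _ (h0 _ _) h)
  refine ⟨fun x y => φ (u x y), ⟨fun _ _ => hφnonneg _, fun x y => congrArg φ (hsymm x y),
    fun x y z => (hwult x y z).trans (max_le_add_of_nonneg (hφnonneg _) (hφnonneg _)),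
    fun x y => (hφeq _).trans (heq x y), fun x t => ?_⟩, hwult, fun _ _ => hφS _, ?_⟩
  · rw [hnhds]
    constructor
    · rintro ⟨ε, hε, h⟩
      refine ⟨φ ε, lt_of_le_of_ne (hφnonneg _) fun h' => hε.ne' ((hφeq ε).1 h'.symm),
        fun y hy => h ?_⟩
      by_contra hlt
      exact absurd (hφmono _ _ hε.le (not_lt.1 hlt)) (not_le.2 hy)
    · rintro ⟨ε, hε, h⟩
      obtain ⟨η, hη, hlt⟩ := hφsmall ε hε
      exact ⟨η, hη, fun y hy => h (hlt _ (h0 _ _) hy)⟩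
  · intro F hne hcl x
    by_cases hx : x ∈ F
    · refine ⟨x, hx, fun b _ => ?_⟩
      change φ (u x x) ≤ _
      rw [(heq x x).2 rfl, hφ0]
      exact hφnonneg _
    obtain ⟨ε, hε, hball⟩ := (hnhds x _).1 (hcl.isOpen_compl.mem_nhds hx)
    have hge : ∀ a ∈ F, ε ≤ u x a := fun a ha => not_lt.1 fun h => hball h ha
    let A : Set ℕ := (fun a => ⌊1 / u x a⌋₊) '' F
    have hA : BddAbove A := by
      refine ⟨⌊1 / ε⌋₊, ?_⟩
      rintro _ ⟨a, ha, rfl⟩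
      exact Nat.floor_le_floor (one_div_le_one_div_of_le hε (hge a ha))
    obtain ⟨a, ha, hmax⟩ := Nat.sSup_mem (hne.image _) hA
    refine ⟨a, ha, fun b hb => ?_⟩
    change φ (u x a) ≤ φ (u x b)
    rw [hφne _ (hε.trans_le (hge a ha)).ne', hφne _ (hε.trans_le (hge b hb)).ne']
    refine hsanti ?_
    have hle : ⌊1 / u x b⌋₊ ≤ sSup A := le_csSup hA ⟨b, hb, rfl⟩
    exact hle.trans_eq hmax.symm

/-- If every point has a nearest point in `F`, nearest points can be chosen to depend
nonexpansively on the point. -/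
theorem IsUltrametricFun.exists_nonexpansive_nearest {X : Type*} [TopologicalSpace X]
    {w : X → X → ℝ} (hw : IsCompatMetric X w) (hult : IsUltrametricFun w) {F : Set X}
    (hnear : ∀ x, ∃ a ∈ F, ∀ b ∈ F, w x a ≤ w x b) :
    ∃ r : X → F, (∀ x, ∀ b ∈ F, w x (r x) ≤ w x b) ∧ ∀ x y, w (r x) (r y) ≤ w x y := by
  obtain ⟨h0, hsymm, -, -, -⟩ := id hw
  let N : X → Set F := fun x => {a | ∀ b ∈ F, w x a ≤ w x b}
  have hN : ∀ x, (N x).Nonempty := fun x =>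
    let ⟨a, ha, h⟩ := hnear x
    ⟨⟨a, ha⟩, h⟩
  obtain ⟨f, hf⟩ : ∃ f : {A : Set F // A.Nonempty} → F, ∀ A, f A ∈ A.1 :=
    ⟨fun A => A.2.some, fun A => A.2.some_mem⟩
  let r : X → F := fun x => f ⟨N x, hN x⟩
  have hr : ∀ x, ∀ b ∈ F, w x (r x) ≤ w x b := fun x => hf ⟨N x, hN x⟩
  have hlt : ∀ x y, w x y < w x (r x) → r x = r y := by
    intro x y hxy
    have hfar : ∀ b ∈ F, w x b = w y b := by
      intro b hb
      have hb' := hxy.trans_le (hr x b hb)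
      have h1 := hult x y b
      have h2 := hult y x b
      rw [hsymm y x, max_eq_right hb'.le] at h2
      rcases le_max_iff.1 h1 with h | h
      · exact absurd h (not_le.2 hb')
      · exact le_antisymm h h2
    have hNxy : N x = N y := by
      ext a
      refine forall₂_congr fun b hb => ?_
      rw [hfar a a.2, hfar b hb]
    simp only [r, hNxy]
  refine ⟨r, hr, fun x y => ?_⟩
  by_cases hx : w x y < w x (r x)
  · rw [hlt x y hx, hw.self_eq_zero]
    exact h0 _ _
  by_cases hy : w y x < w y (r y)
  · rw [hlt y x hy, hw.self_eq_zero]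
    exact h0 _ _
  rw [hsymm y x] at hy
  have h1 := hult (r x) x (r y)
  have h2 := hult x y (r y)
  rw [hsymm _ x] at h1
  exact h1.trans (max_le (not_lt.1 hx) (h2.trans (max_le le_rfl (not_lt.1 hy))))

/-- Collapsing `F` to a point: `δ` plays the role of the distance to `F`. -/
theorem IsUltrametricFun.min_max {X : Type*} {w : X → X → ℝ} (hult : IsUltrametricFun w)
    {δ : X → ℝ} (hsymm : ∀ x y, w x y = w y x) (hδ : ∀ x y, δ x ≤ max (w x y) (δ y)) :
    IsUltrametricFun fun x y => min (w x y) (max (δ x) (δ y)) := by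
  intro x y z
  have h1 := hult x y z
  have h2 := hδ x y
  have h3 := hδ z y
  rw [hsymm z y] at h3
  simp only [le_max_iff, min_le_iff, le_min_iff, max_le_iff] at *
  grind

theorem IsUltrametricFun.max {Y : Type*} {d e : Y → Y → ℝ} (hd : IsUltrametricFun d)
    (he : IsUltrametricFun e) : IsUltrametricFun fun x y => max (d x y) (e x y) := fun x y z =>
  (max_le_max (hd x y z) (he x y z)).trans_eq (max_max_max_comm _ _ _ _)

theorem uDist_max_comp {X Y : Type*} (S : Set ℝ) {r : X → Y} {i : Y → X} {ρ : X → X → ℝ}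
    {d e : Y → Y → ℝ} (hd : ∀ a b, max (d (r (i a)) (r (i b))) (ρ (i a) (i b)) = d a b)
    (he : ∀ a b, max (e (r (i a)) (r (i b))) (ρ (i a) (i b)) = e a b) :
    uDist S (fun x y => max (d (r x) (r y)) (ρ x y)) (fun x y => max (e (r x) (r y)) (ρ x y)) =
      uDist S d e := by
  unfold uDist
  congr 2
  ext ε
  refine and_congr_right fun _ => and_congr_right fun _ => ⟨fun h a b => ?_, fun h x y => ?_⟩
  · simpa only [hd, he] using h (i a) (i b)
  · obtain ⟨h1, h2⟩ := h (r x) (r y)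
    rw [max_right_comm, max_right_comm (d _ _)]
    exact ⟨max_le_max_right _ h1, max_le_max_right _ h2⟩

/-- Pulling back a compatible metric along a nonexpansive nearest point map and adding the
metric obtained by collapsing `F` gives a compatible metric. -/
theorem IsCompatMetric.max_nearest {X : Type*} [TopologicalSpace X] {w : X → X → ℝ}
    (hw : IsCompatMetric X w) (hult : IsUltrametricFun w) {F : Set X} {r : X → F}
    (hr : ∀ x, ∀ b ∈ F, w x (r x) ≤ w x b) (hlip : ∀ x y, w (r x) (r y) ≤ w x y)
    (hρult : IsUltrametricFun fun x y => min (w x y) (max (w x (r x)) (w y (r y))))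
    {d : F → F → ℝ} (hd : IsCompatMetric F d) :
    IsCompatMetric X fun x y =>
      max (d (r x) (r y)) (min (w x y) (max (w x (r x)) (w y (r y)))) := by
  have hwF := (hw.subtype F).2.2.2.2
  have hwself := hw.self_eq_zero
  have hdself := hd.self_eq_zero
  obtain ⟨w0, wsymm, -, weq, wnhds⟩ := hw
  obtain ⟨d0, dsymm, dtri, -, dnhds⟩ := hd
  have hρ0 : ∀ x y, 0 ≤ min (w x y) (max (w x (r x)) (w y (r y))) := fun x y =>
    le_min (w0 _ _) (le_max_of_le_left (w0 _ _))
  have key : ∀ x, ∀ s ∈ nhds x, ∃ ε > 0, {y | max (d (r x) (r y))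
      (min (w x y) (max (w x (r x)) (w y (r y)))) < ε} ⊆ s := by
    intro x s hs
    obtain ⟨ε, hε, hball⟩ := (wnhds x s).1 hs
    rcases (w0 x (r x)).eq_or_lt with hx | hx
    · have hrx : x = r x := (weq _ _).1 hx.symm
      obtain ⟨η, hη, hdη⟩ := (dnhds (r x) _).1
        ((hwF (r x) {b | w (r x) b < ε}).2 ⟨ε, hε, subset_rfl⟩)
      refine ⟨min ε η, lt_min hε hη, fun y hy => hball ?_⟩
      rw [Set.mem_ofPred_eq, max_lt_iff] at hy
      obtain ⟨hy1, hy2⟩ := hy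
      have hy1' : w (r x) (r y) < ε := hdη (hy1.trans_le (min_le_right _ _))
      rw [← hrx] at hy1'
      have hy3 : w y (r y) < ε := by
        have hle : w y (r y) ≤ w x y := by
          rw [wsymm x y, hrx]; exact hr y _ (r x).2
        exact (le_min hle (le_max_right _ _)).trans_lt (hy2.trans_le (min_le_left _ _))
      rw [wsymm] at hy3
      exact (hult x (r y) y).trans_lt (max_lt hy1' hy3)
    · refine ⟨min ε (w x (r x)), lt_min hε hx, fun y hy => hball ?_⟩
      rw [Set.mem_ofPred_eq, max_lt_iff, min_lt_iff] at hy
      rcases hy.2 with h | h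
      · exact h.trans_le (min_le_left _ _)
      · exact absurd ((le_max_left _ _).trans_lt (h.trans_le (min_le_right _ _))) (lt_irrefl _)
  refine ⟨fun x y => le_max_of_le_left (d0 _ _), fun x y => ?_, fun x y z => ?_, fun x y => ?_,
    fun x s => ⟨key x s, ?_⟩⟩
  · beta_reduce
    rw [dsymm, wsymm x y, max_comm (w x _)]
  · refine max_le ((dtri _ (r y) _).trans (add_le_add (le_max_left _ _) (le_max_left _ _))) ?_
    exact ((hρult x y z).trans (max_le_add_of_nonneg (hρ0 _ _) (hρ0 _ _))).trans
      (add_le_add (le_max_right _ _) (le_max_right _ _))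
  · refine ⟨fun h => ?_, fun h => ?_⟩
    · by_contra hxy
      have hs : {z | w x z < w x y} ∈ nhds x := (wnhds _ _).2
        ⟨w x y, (w0 x y).lt_of_ne fun h' => hxy ((weq _ _).1 h'.symm), subset_rfl⟩
      obtain ⟨ε, hε, hsub⟩ := key x _ hs
      exact lt_irrefl (w x y) (hsub (h.trans_lt hε))
    · subst h
      beta_reduce
      rw [hdself, hwself, min_eq_left (le_max_of_le_left (w0 _ _)), max_self]
  · rintro ⟨ε, hε, hsub⟩
    obtain ⟨η, hη, hwη⟩ := (hwF (r x) _).1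
      ((dnhds (r x) {b | d (r x) b < ε}).2 ⟨ε, hε, subset_rfl⟩)
    refine (wnhds x s).2 ⟨min ε η, lt_min hε hη, fun y hy => hsub ?_⟩
    refine Set.mem_ofPred_eq ▸ max_lt ?_ ?_
    · exact hwη ((hlip x y).trans_lt (lt_of_lt_of_le hy (min_le_right _ _)))
    · exact (min_le_left _ _).trans_lt (lt_of_lt_of_le hy (min_le_left _ _))

theorem exists_ultrametric_extensor {X : Type*} [TopologicalSpace X]
    (hu : ∃ u : X → X → ℝ, IsCompatMetric X u ∧ IsUltrametricFun u)
    (F : Set X) (hFne : F.Nonempty) (hFcl : IsClosed F)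
    (S : Set ℝ) (hS : CharacteristicSet S) :
    ∃ Sig : (↥F → ↥F → ℝ) → (X → X → ℝ),
      (∀ d, IsCompatMetric ↥F d → IsCompatMetric X (Sig d)) ∧
      -- (1) extension
      (∀ d, IsCompatMetric ↥F d → ∀ a b : ↥F, Sig d (a : X) (b : X) = d a b) ∧
      -- (2) u^S-isometry
      (∀ d e, IsCompatMetric ↥F d → IsCompatMetric ↥F e →
        uDist S (Sig d) (Sig e) = uDist S d e) ∧
      -- (3) monotonicity
      (∀ d e, IsCompatMetric ↥F d → IsCompatMetric ↥F e →
        (∀ a b : ↥F, d a b ≤ e a b) → ∀ x y : X, Sig d x y ≤ Sig e x y) ∧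
      -- (4) compatibility with pointwise maxima
      (∀ d e, IsCompatMetric ↥F d → IsCompatMetric ↥F e →
        ∀ x y : X, Sig (fun a b => max (d a b) (e a b)) x y = max (Sig d x y) (Sig e x y)) ∧
      -- (5) preservation of S-valued ultrametrics
      (∀ d, IsCompatMetric ↥F d → IsUltrametricFun d → (∀ a b : ↥F, d a b ∈ S) →
        IsUltrametricFun (Sig d) ∧ ∀ x y : X, Sig d x y ∈ S) := by
  obtain ⟨w, hw, hult, hwS, hnear⟩ := exists_ultrametric_forall_exists_nearest hu hS
  obtain ⟨r, hr, hlip⟩ := hult.exists_nonexpansive_nearest hw (hnear F hFne hFcl)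
  have hsymm := hw.2.1
  have hδ : ∀ x y, w x (r x) ≤ max (w x y) (w y (r y)) := fun x y =>
    (hr x _ (r y).2).trans (hult _ _ _)
  have hρult := hult.min_max hsymm hδ
  have hrF : ∀ a : F, w a (r a) = 0 := fun a =>
    le_antisymm ((hr a a a.2).trans_eq (hw.self_eq_zero _)) (hw.1 _ _)
  have hra : ∀ a : F, r a = a := fun a => (Subtype.ext ((hw.2.2.2.1 _ _).1 (hrF a))).symm
  have hext : ∀ d, IsCompatMetric ↥F d → ∀ a b : ↥F,
      max (d (r a) (r b)) (min (w a b) (max (w a (r a)) (w b (r b)))) = d a b := by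
    intro d hd a b
    rw [hrF, hrF, hra, hra, max_self, min_eq_right (hw.1 _ _), max_eq_left (hd.1 _ _)]
  have hmaxS : ∀ s ∈ S, ∀ t ∈ S, max s t ∈ S := fun s hs t ht => by
    rcases max_choice s t with h | h <;> rw [h] <;> assumption
  have hminS : ∀ s ∈ S, ∀ t ∈ S, min s t ∈ S := fun s hs t ht => by
    rcases min_choice s t with h | h <;> rw [h] <;> assumption
  refine ⟨fun d x y => max (d (r x) (r y)) (min (w x y) (max (w x (r x)) (w y (r y)))),
    fun d hd => hw.max_nearest hult hr hlip hρult hd, hext,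
    fun d e hd he => uDist_max_comp S (hext d hd) (hext e he),
    fun d e _ _ hle x y => max_le_max_right _ (hle _ _),
    fun d e _ _ x y => sup_sup_distrib_right _ _ _, fun d _ hdult hdS => ⟨?_, fun x y => ?_⟩⟩
  · exact IsUltrametricFun.max (fun x y z => hdult (r x) (r y) (r z)) hρult
  · exact hmaxS _ (hdS _ _) _ (hminS _ (hwS _ _) _ (hmaxS _ (hwS _ _) _ (hwS _ _)))
end

section
/- Let X be a completely metrizable topological space admitting a compatible ultrametric, let F be a nonempty closed subset of X, and let S be a characteristic subset of [0, ∞). Then there exists a map Σ : Met(F) → Met(X) satisfying properties (1)–(5) (extension; u^S-isometry; monotonicity; compatibility with pointwise maxima; preservation of S-valued ultrametrics) and, in addition, Σ maps every complete metric in Met(F) to a complete metric in Met(X); in particular, Σ maps every complete ultrametric on F taking values in S to a complete ultrametric on X taking values in S. -/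
open Filter

/-- A metric (as a bare function) is complete if every Cauchy sequence converges. -/
def IsCompleteMetricFun {Y : Type*} (d : Y → Y → ℝ) : Prop :=
  ∀ x : ℕ → Y, (∀ ε : ℝ, 0 < ε → ∃ N : ℕ, ∀ m ≥ N, ∀ n ≥ N, d (x m) (x n) < ε) →
    ∃ l : Y, Tendsto (fun n => d (x n) l) atTop (nhds 0)

open Topology

/-- A decreasing sequence of equivalence relations whose classes are open, form neighbourhood
bases, and are complete for the induced uniformity. -/
structure IsCompleteFiltration {X : Type*} [TopologicalSpace X] (E : ℕ → X → X → Prop) :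
    Prop where
  equiv : ∀ n, Equivalence (E n)
  anti : ∀ {m n}, m ≤ n → ∀ {x y}, E n x y → E m x y
  mem_nhds : ∀ n x, {y | E n x y} ∈ 𝓝 x
  basis : ∀ {x s}, s ∈ 𝓝 x → ∃ n, {y | E n x y} ⊆ s
  sep : ∀ {x y}, (∀ n, E n x y) → x = y
  complete : ∀ x : ℕ → X, (∀ n, ∃ K, ∀ k ≥ K, ∀ l ≥ K, E n (x k) (x l)) →
    ∃ l, Tendsto x atTop (𝓝 l)

/-- Convergence in a space is convergence to zero of the distance, for a compatible metric. -/
lemma IsCompatMetric.tendsto_iff {Y : Type*} [TopologicalSpace Y] {d : Y → Y → ℝ}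
    (hd : IsCompatMetric Y d) {x : ℕ → Y} {l : Y} :
    Tendsto (fun n => d (x n) l) atTop (𝓝 0) ↔ Tendsto x atTop (𝓝 l) := by
  obtain ⟨h0, hs, -, -, hn⟩ := hd
  rw [Metric.tendsto_atTop]
  constructor
  · intro h s hsl
    obtain ⟨ε, hε, hb⟩ := (hn l s).1 hsl
    obtain ⟨N, hN⟩ := h ε hε
    refine mem_map.2 (mem_atTop_sets.2 ⟨N, fun n hn => hb ?_⟩)
    have := hN n hn
    rw [Real.dist_0_eq_abs, abs_of_nonneg (h0 _ _), hs] at this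
    exact this
  · intro h ε hε
    obtain ⟨N, hN⟩ := mem_atTop_sets.1 (mem_map.1 (h ((hn l _).2 ⟨ε, hε, subset_rfl⟩)))
    refine ⟨N, fun n hn => ?_⟩
    rw [Real.dist_0_eq_abs, abs_of_nonneg (h0 _ _), hs]
    exact hN n hn

/-- A completely metrizable, ultrametrizable space admits a complete filtration. -/
lemma exists_isCompleteFiltration {X : Type*} [TopologicalSpace X] {d u : X → X → ℝ}
    (hd : IsCompatMetric X d) (hdc : IsCompleteMetricFun d)
    (hu : IsCompatMetric X u) (huu : IsUltrametricFun u) :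
    ∃ E : ℕ → X → X → Prop, IsCompleteFiltration E := by
  have htend := @hd.tendsto_iff
  obtain ⟨d0, ds, dt, dz, dn⟩ := hd
  obtain ⟨u0, us, -, uz, un⟩ := hu
  have uxx : ∀ x, u x x = 0 := fun x => (uz x x).2 rfl
  have dxx : ∀ x, d x x = 0 := fun x => (dz x x).2 rfl
  let E : ℕ → X → X → Prop := fun n x y => ∃ r > 0, u x y < r ∧
    ∀ z w, u x z < r → u x w < r → d z w < (1 / 2 : ℝ) ^ n
  have hball : ∀ {x y z : X} {r : ℝ}, u x y < r → u y z < r → u x z < r := fun h h' =>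
    (huu _ _ _).trans_lt (max_lt h h')
  have hpow : ∀ n : ℕ, (0 : ℝ) < (1 / 2) ^ n := fun n => by positivity
  have hloc : ∀ n x, ∃ r > 0, ∀ z w, u x z < r → u x w < r → d z w < (1 / 2 : ℝ) ^ n := by
    intro n x
    obtain ⟨r, hr, hb⟩ := (un x _).1 ((dn x _).2 ⟨(1 / 2 : ℝ) ^ n / 2, half_pos (hpow n),
      subset_rfl⟩)
    refine ⟨r, hr, fun z w hz hw => ?_⟩
    have h1 : d x z < _ := hb hz
    have h2 : d x w < _ := hb hw
    have := dt z x w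
    rw [ds z x] at this
    linarith
  have hlt : ∀ {n x y}, E n x y → d x y < (1 / 2 : ℝ) ^ n := by
    rintro n x y ⟨r, hr, hxy, h⟩
    exact h x y (by rw [uxx]; exact hr) hxy
  have hsymm : ∀ {n x y}, E n x y → E n y x := by
    rintro n x y ⟨r, hr, hxy, h⟩
    exact ⟨r, hr, us x y ▸ hxy, fun z w hz hw => h z w (hball hxy hz) (hball hxy hw)⟩
  have hsmall : ∀ {ε : ℝ}, 0 < ε → ∃ n : ℕ, (1 / 2 : ℝ) ^ n < ε := fun hε =>
    exists_pow_lt_of_lt_one hε (by norm_num)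
  refine ⟨E, ⟨fun n => ⟨fun x => ?_, hsymm, ?_⟩, ?_, ?_, ?_, ?_, ?_⟩⟩
  · obtain ⟨r, hr, h⟩ := hloc n x
    exact ⟨r, hr, by rw [uxx]; exact hr, h⟩
  · rintro x y z ⟨r, hr, hxy, h⟩ ⟨t, ht, hyz, h'⟩
    rcases le_total t r with htr | htr
    · exact ⟨r, hr, hball hxy (hyz.trans_le htr), h⟩
    · have hxy' : u x y < t := hxy.trans_le htr
      have hyx : u y x < t := us x y ▸ hxy'
      exact ⟨t, ht, hball hxy' hyz, fun a b ha hb => h' a b (hball hyx ha) (hball hyx hb)⟩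
  · rintro m n hmn x y ⟨r, hr, hxy, h⟩
    exact ⟨r, hr, hxy, fun z w hz hw => (h z w hz hw).trans_le
      (pow_le_pow_of_le_one (by norm_num) (by norm_num) hmn)⟩
  · intro n x
    obtain ⟨r, hr, h⟩ := hloc n x
    exact (un x _).2 ⟨r, hr, fun y hy => ⟨r, hr, hy, h⟩⟩
  · intro x s hs
    obtain ⟨ε, hε, hb⟩ := (dn x s).1 hs
    obtain ⟨n, hn⟩ := hsmall hε
    exact ⟨n, fun y hy => hb ((hlt hy).trans hn)⟩
  · intro x y h
    refine (dz x y).1 (le_antisymm (le_of_forall_pos_lt_add fun ε hε => ?_) (d0 x y))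
    obtain ⟨n, hn⟩ := hsmall hε
    linarith [hlt (h n)]
  · intro x hx
    obtain ⟨l, hl⟩ := hdc x fun ε hε => by
      obtain ⟨n, hn⟩ := hsmall hε
      obtain ⟨K, hK⟩ := hx n
      exact ⟨K, fun k hk l hl => (hlt (hK k hk l hl)).trans hn⟩
    exact ⟨l, htend.1 hl⟩

/-- A characteristic set contains a strictly decreasing positive null sequence. -/
lemma CharacteristicSet.exists_strictAnti {S : Set ℝ} (hS : CharacteristicSet S) :
    ∃ s : ℕ → ℝ, StrictAnti s ∧ (∀ n, 0 < s n) ∧ (∀ n, s n ∈ S) ∧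
      ∀ ε > 0, ∃ n, s n < ε := by
  obtain ⟨-, -, h⟩ := hS
  choose! f hf using h
  let s : ℕ → ℝ := fun n => Nat.rec (f 1) (fun _ t => f (t / 2)) n
  have hpos : ∀ n, 0 < s n := by
    intro n
    induction n with
    | zero => exact (hf 1 one_pos).2.1
    | succ n ih => exact (hf _ (half_pos ih)).2.1
  have hhalf : ∀ n, s (n + 1) ≤ s n / 2 := fun n => (hf _ (half_pos (hpos n))).2.2
  have hle : ∀ n, s n ≤ (1 / 2 : ℝ) ^ n := by
    intro n
    induction n with
    | zero => rw [pow_zero]; exact (hf 1 one_pos).2.2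
    | succ n ih => rw [pow_succ]; linarith [hhalf n]
  refine ⟨s, strictAnti_nat_of_succ_lt fun n => ?_, hpos, fun n => ?_, fun ε hε => ?_⟩
  · linarith [hhalf n, hpos n]
  · cases n with
    | zero => exact (hf 1 one_pos).1
    | succ n => exact (hf _ (half_pos (hpos n))).1
  · obtain ⟨n, hn⟩ := exists_pow_lt_of_lt_one hε (show (1 / 2 : ℝ) < 1 by norm_num)
    exact ⟨n, (hle n).trans_lt hn⟩

/-- A decreasing sequence of equivalence relations is the sequence of balls of an ultrametric
pseudodistance with prescribed values. -/
lemma exists_pseudoUltrametric {X : Type*} {R : ℕ → X → X → Prop}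
    (hR : ∀ n, Equivalence (R n)) (hanti : ∀ {m n}, m ≤ n → ∀ {x y}, R n x y → R m x y)
    {S : Set ℝ} (h0S : (0 : ℝ) ∈ S) {s : ℕ → ℝ} (hs : StrictAnti s) (hpos : ∀ n, 0 < s n)
    (hsS : ∀ n, s n ∈ S) :
    ∃ ρ : X → X → ℝ, (∀ x y, 0 ≤ ρ x y) ∧ (∀ x y, ρ x y = ρ y x) ∧ IsUltrametricFun ρ ∧
      (∀ x y, ρ x y ∈ S) ∧ (∀ n x y, ρ x y < s n ↔ R n x y) ∧
      ∀ x y, (∀ n, R n x y) → ρ x y = 0 := by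
  classical
  let ρ : X → X → ℝ := fun x y => if h : ∃ n, ¬ R n x y then s (Nat.find h) else 0
  have hzero : ∀ {x y}, (∀ n, R n x y) → ρ x y = 0 := fun h =>
    dif_neg (by push Not; exact h)
  have hval : ∀ {x y}, (∃ n, ¬ R n x y) → ∃ n, ρ x y = s n ∧ ¬ R n x y ∧ ∀ m < n, R m x y :=
    fun h => ⟨Nat.find h, dif_pos h, Nat.find_spec h, fun m hm => not_not.1 (Nat.find_min h hm)⟩
  have hlt : ∀ n x y, ρ x y < s n ↔ R n x y := by
    intro n x y
    by_cases h : ∃ n, ¬ R n x y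
    · obtain ⟨k, hk, hnk, hmin⟩ := hval h
      rw [hk, hs.lt_iff_gt]
      exact ⟨fun h => hmin n h, fun h => not_le.1 fun hkn => hnk (hanti hkn h)⟩
    · push Not at h
      rw [hzero h]
      exact iff_of_true (hpos n) (h n)
  have hcases : ∀ x y, ρ x y = 0 ∨ ∃ n, ρ x y = s n ∧ ¬ R n x y := by
    intro x y
    by_cases h : ∃ n, ¬ R n x y
    · obtain ⟨k, hk, hnk, -⟩ := hval h
      exact Or.inr ⟨k, hk, hnk⟩
    · push Not at h
      exact Or.inl (hzero h)
  have hnonneg : ∀ x y, 0 ≤ ρ x y := by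
    intro x y
    rcases hcases x y with h | ⟨n, h, -⟩
    · exact h.ge
    · exact h ▸ (hpos n).le
  have hle : ∀ x y, ρ x y ≤ ρ y x := by
    intro x y
    rcases hcases x y with h | ⟨n, h, hn⟩
    · exact h ▸ hnonneg y x
    · rw [h]
      exact not_lt.1 fun hlt' => hn ((hR n).symm ((hlt n y x).1 hlt'))
  refine ⟨ρ, hnonneg, fun x y => le_antisymm (hle x y) (hle y x), ?_, ?_, hlt,
    fun x y h => hzero h⟩
  · intro x y z
    rcases hcases x z with h | ⟨n, h, hn⟩
    · exact h ▸ le_max_of_le_left (hnonneg x y)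
    · rw [h]
      refine not_lt.1 fun hlt' => hn ?_
      rw [max_lt_iff, hlt, hlt] at hlt'
      exact (hR n).trans hlt'.1 hlt'.2
  · intro x y
    rcases hcases x y with h | ⟨n, h, -⟩
    · exact h ▸ h0S
    · exact h ▸ hsS n

/-- `x` is `E n`-related to some point of `F`. -/
def InSaturation {X : Type*} (E : ℕ → X → X → Prop) (F : Set X) (n : ℕ) (x : X) : Prop :=
  ∃ a ∈ F, E n x a

namespace IsCompleteFiltration

variable {X : Type*} [TopologicalSpace X] {E : ℕ → X → X → Prop} {F : Set X}

lemma inSaturation_of_mem (hE : IsCompleteFiltration E) {x : X} (hx : x ∈ F) (n : ℕ) :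
    InSaturation E F n x :=
  ⟨x, hx, (hE.equiv n).refl x⟩

lemma inSaturation_anti (hE : IsCompleteFiltration E) {m n : ℕ} (h : m ≤ n) {x : X}
    (hx : InSaturation E F n x) : InSaturation E F m x :=
  let ⟨a, ha, hxa⟩ := hx
  ⟨a, ha, hE.anti h hxa⟩

lemma inSaturation_congr (hE : IsCompleteFiltration E) {n : ℕ} {x y : X} (h : E n x y) :
    InSaturation E F n x ↔ InSaturation E F n y :=
  ⟨fun ⟨a, ha, hxa⟩ => ⟨a, ha, (hE.equiv n).trans ((hE.equiv n).symm h) hxa⟩,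
    fun ⟨a, ha, hya⟩ => ⟨a, ha, (hE.equiv n).trans h hya⟩⟩

lemma exists_not_inSaturation (hE : IsCompleteFiltration E) (hF : IsClosed F) {x : X}
    (hx : x ∉ F) : ∃ n, ¬ InSaturation E F n x := by
  obtain ⟨n, hn⟩ := hE.basis (hF.isOpen_compl.mem_nhds hx)
  exact ⟨n, fun ⟨a, ha, hxa⟩ => hn hxa ha⟩

/-- Each `E n` with the saturation of `F` collapsed to one class is an equivalence relation. -/
lemma collapse_equivalence (hE : IsCompleteFiltration E) (n : ℕ) :
    Equivalence fun x y => E n x y ∨ InSaturation E F n x ∧ InSaturation E F n y := by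
  refine ⟨fun x => Or.inl ((hE.equiv n).refl x), ?_, ?_⟩
  · rintro x y (h | h)
    · exact Or.inl ((hE.equiv n).symm h)
    · exact Or.inr h.symm
  · rintro x y z (h | h) (h' | h')
    · exact Or.inl ((hE.equiv n).trans h h')
    · exact Or.inr ⟨(hE.inSaturation_congr h).2 h'.1, h'.2⟩
    · exact Or.inr ⟨h.1, (hE.inSaturation_congr h').1 h.2⟩
    · exact Or.inr ⟨h.1, h'.2⟩

/-- There is a continuous retraction onto a nonempty closed set which moves each point no further
than the filtration requires. -/
lemma exists_retraction (hE : IsCompleteFiltration E) (hFne : F.Nonempty) (hF : IsClosed F) :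
    ∃ r : X → F, Continuous r ∧ (∀ a : F, r a = a) ∧
      ∀ n x, InSaturation E F n x → E n x (r x) := by
  classical
  obtain ⟨a₀, ha₀⟩ := hFne
  let pick : Set F → F := fun A => if h : A.Nonempty then h.some else ⟨a₀, ha₀⟩
  have hpick : ∀ {A : Set F}, A.Nonempty → pick A ∈ A := fun {A} h => by
    simp only [pick, dif_pos h]
    exact h.some_mem
  let level : X → ℕ := fun x => sInf {n | ¬ InSaturation E F n x}
  let r : X → F := fun x =>
    if h : x ∈ F then ⟨x, h⟩ else pick {a : F | E (level x - 1) x a}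
  have hr_mem : ∀ {x} (h : x ∈ F), r x = ⟨x, h⟩ := fun h => dif_pos h
  have hr_not : ∀ {x}, x ∉ F → r x = pick {a : F | E (level x - 1) x a} := fun h => dif_neg h
  have hlevel : ∀ {x}, x ∉ F → ¬ InSaturation E F (level x) x := fun h =>
    Nat.sInf_mem (hE.exists_not_inSaturation hF h)
  have hlevel_lt : ∀ {x n}, n < level x → InSaturation E F n x := fun h =>
    not_not.1 (Nat.notMem_of_lt_sInf h)
  have hclose : ∀ n x, InSaturation E F n x → E n x (r x) := by
    intro n x hx
    by_cases hxF : x ∈ F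
    · rw [hr_mem hxF]
      exact (hE.equiv n).refl x
    · have hn : n < level x := by
        by_contra hcon
        exact hlevel hxF (hE.inSaturation_anti (not_lt.1 hcon) hx)
      obtain ⟨a, ha, hxa⟩ := hlevel_lt (show level x - 1 < level x by omega)
      have hmem : E (level x - 1) x (r x) := by
        rw [hr_not hxF]
        exact hpick (A := {a : F | E (level x - 1) x a}) ⟨⟨a, ha⟩, hxa⟩
      exact hE.anti (by omega) hmem
  refine ⟨r, continuous_iff_continuousAt.2 fun x => ?_, fun a => hr_mem a.2, hclose⟩
  by_cases hxF : x ∈ F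
  · rw [ContinuousAt, tendsto_subtype_rng, hr_mem hxF]
    intro s hs
    obtain ⟨n, hn⟩ := hE.basis hs
    rw [mem_map]
    filter_upwards [hE.mem_nhds n x] with y hy
    exact hn ((hE.equiv n).trans hy
      (hclose n y ((hE.inSaturation_congr hy).1 (hE.inSaturation_of_mem hxF n))))
  · refine tendsto_nhds_of_eventually_eq ?_
    filter_upwards [hE.mem_nhds (level x) x] with y hy
    have hyn : ¬ InSaturation E F (level x) y := fun h =>
      hlevel hxF ((hE.inSaturation_congr hy).2 h)
    have hyF : y ∉ F := fun h => hyn (hE.inSaturation_of_mem h _)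
    have hlev : level y = level x := by
      refine le_antisymm (Nat.sInf_le hyn) (not_lt.1 fun h => hlevel hyF ?_)
      exact (hE.inSaturation_congr (hE.anti h.le hy)).1 (hlevel_lt h)
    rw [hr_not hyF, hr_not hxF, hlev]
    have hy' := hE.anti (Nat.sub_le (level x) 1) hy
    congr 1
    ext a
    exact ⟨fun h => (hE.equiv _).trans hy' h,
      fun h => (hE.equiv _).trans ((hE.equiv _).symm hy') h⟩

end IsCompleteFiltration

theorem exists_ultrametric_extensor_complete {X : Type*} [TopologicalSpace X]
    (hcm : ∃ d₀ : X → X → ℝ, IsCompatMetric X d₀ ∧ IsCompleteMetricFun d₀)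
    (hu : ∃ u : X → X → ℝ, IsCompatMetric X u ∧ IsUltrametricFun u)
    (F : Set X) (hFne : F.Nonempty) (hFcl : IsClosed F)
    (S : Set ℝ) (hS : CharacteristicSet S) :
    ∃ Sig : (↥F → ↥F → ℝ) → (X → X → ℝ),
      (∀ d, IsCompatMetric ↥F d → IsCompatMetric X (Sig d)) ∧
      -- (1) extension
      (∀ d, IsCompatMetric ↥F d → ∀ a b : ↥F, Sig d (a : X) (b : X) = d a b) ∧
      -- (2) u^S-isometry
      (∀ d e, IsCompatMetric ↥F d → IsCompatMetric ↥F e →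
        uDist S (Sig d) (Sig e) = uDist S d e) ∧
      -- (3) monotonicity
      (∀ d e, IsCompatMetric ↥F d → IsCompatMetric ↥F e →
        (∀ a b : ↥F, d a b ≤ e a b) → ∀ x y : X, Sig d x y ≤ Sig e x y) ∧
      -- (4) compatibility with pointwise maxima
      (∀ d e, IsCompatMetric ↥F d → IsCompatMetric ↥F e →
        ∀ x y : X, Sig (fun a b => max (d a b) (e a b)) x y = max (Sig d x y) (Sig e x y)) ∧
      -- (5) preservation of S-valued ultrametrics
      (∀ d, IsCompatMetric ↥F d → IsUltrametricFun d → (∀ a b : ↥F, d a b ∈ S) →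
        IsUltrametricFun (Sig d) ∧ ∀ x y : X, Sig d x y ∈ S) ∧
      -- preservation of completeness
      (∀ d, IsCompatMetric ↥F d → IsCompleteMetricFun d → IsCompleteMetricFun (Sig d)) := by
  obtain ⟨d₀, hd₀, hd₀c⟩ := hcm
  obtain ⟨u, hu, huu⟩ := hu
  obtain ⟨E, hE⟩ := exists_isCompleteFiltration hd₀ hd₀c hu huu
  obtain ⟨s, hs, hspos, hsS, hsmall⟩ := hS.exists_strictAnti
  obtain ⟨r, hrc, hrF, hclose⟩ := hE.exists_retraction hFne hFcl
  obtain ⟨ρ, ρ0, ρs, ρu, ρS, ρlt, ρz⟩ := exists_pseudoUltrametric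
    (fun n => hE.collapse_equivalence (F := F) n)
    (fun hmn _ _ h => h.imp (hE.anti hmn)
      fun h => ⟨hE.inSaturation_anti hmn h.1, hE.inSaturation_anti hmn h.2⟩)
    hS.2.1 hs hspos hsS
  have ρF : ∀ a b : F, ρ a b = 0 := fun a b => ρz a b fun n =>
    Or.inr ⟨hE.inSaturation_of_mem a.2 n, hE.inSaturation_of_mem b.2 n⟩
  have ρE : ∀ {n x y}, ¬ InSaturation E F n x → ρ x y < s n → E n x y := fun hx h =>
    ((ρlt _ _ _).1 h).resolve_right fun h => hx h.1
  let Sig : (F → F → ℝ) → X → X → ℝ := fun d x y => max (d (r x) (r y)) (ρ x y)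
  have hext : ∀ d, IsCompatMetric F d → ∀ a b : F, Sig d a b = d a b := fun d hd a b => by
    simp only [Sig, hrF, ρF, max_eq_left (hd.1 a b)]
  have hcompat : ∀ d, IsCompatMetric F d → IsCompatMetric X (Sig d) := by
    rintro d ⟨d0, ds, dt, dz, dn⟩
    have hball : ∀ {x t}, t ∈ 𝓝 x → ∃ ε > 0, {y | Sig d x y < ε} ⊆ t := by
      intro x t ht
      obtain ⟨n, hn⟩ := hE.basis ht
      by_cases hx : x ∈ F
      · lift x to F using hx
        obtain ⟨δ, hδ, hδs⟩ := (dn x _).1 (preimage_coe_mem_nhds_subtype.2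
          (mem_nhdsWithin_of_mem_nhds (hE.mem_nhds n x)))
        refine ⟨min δ (s n), lt_min hδ (hspos n), fun y hy => hn ?_⟩
        obtain ⟨h1, h2⟩ := max_lt_iff.1 (show max (d (r x) (r y)) (ρ x y) < _ from hy)
        rcases (ρlt n x y).1 (h2.trans_le (min_le_right _ _)) with h | ⟨-, h⟩
        · exact h
        · rw [hrF] at h1
          have hxy : E n x (r y) := hδs (h1.trans_le (min_le_left _ _))
          exact (hE.equiv n).trans hxy ((hE.equiv n).symm (hclose n y h))
      · obtain ⟨m, hm⟩ := hE.exists_not_inSaturation hFcl hx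
        refine ⟨s (max n m), hspos _, fun y hy => hn ?_⟩
        exact hE.anti (le_max_left n m) (ρE
          (fun h => hm (hE.inSaturation_anti (le_max_right n m) h))
          (max_lt_iff.1 (show max (d (r x) (r y)) (ρ x y) < _ from hy)).2)
    refine ⟨fun x y => le_max_of_le_right (ρ0 x y), fun x y => ?_, fun x y z => ?_,
      fun x y => ⟨fun h => ?_, ?_⟩, fun x t => ⟨hball, ?_⟩⟩
    · simp only [Sig, ds (r x), ρs x]
    · refine max_le ((dt _ (r y) _).trans (add_le_add (le_max_left _ _) (le_max_left _ _))) ?_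
      exact (ρu x y z).trans ((max_le_add_of_nonneg (ρ0 _ _) (ρ0 _ _)).trans
        (add_le_add (le_max_right _ _) (le_max_right _ _)))
    · refine hE.sep fun n => ?_
      obtain ⟨ε, hε, hb⟩ := hball (hE.mem_nhds n x)
      exact hb (show Sig d x y < ε from h ▸ hε)
    · rintro rfl
      simp only [Sig, (dz _ _).2, ρz x x fun n => Or.inl ((hE.equiv n).refl x), max_self]
    · rintro ⟨ε, hε, hb⟩
      obtain ⟨n, hn⟩ := hsmall ε hε
      filter_upwards [hE.mem_nhds n x,
        hrc.continuousAt.preimage_mem_nhds ((dn (r x) _).2 ⟨ε, hε, subset_rfl⟩)] with y hy hy'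
      exact hb (max_lt hy' (((ρlt n x y).2 (Or.inl hy)).trans hn))
  refine ⟨Sig, hcompat, hext, ?_, ?_, ?_, ?_, ?_⟩
  · intro d e hd he
    have hle : ∀ {d e : F → F → ℝ} {ε : ℝ}, (∀ a b, d a b ≤ max (e a b) ε) →
        ∀ x y, Sig d x y ≤ max (Sig e x y) ε := fun h x y =>
      max_le ((h _ _).trans (max_le_max_right _ (le_max_left _ _)))
        (le_max_of_le_left (le_max_right _ _))
    unfold uDist
    congr 2
    ext ε
    refine and_congr_right fun _ => and_congr_right fun _ => ⟨fun h a b => ?_, fun h x y => ?_⟩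
    · simpa only [hext d hd, hext e he] using h a b
    · exact ⟨hle (fun a b => (h a b).1) x y, hle (fun a b => (h a b).2) x y⟩
  · exact fun d e _ _ h x y => max_le_max_right _ (h _ _)
  · exact fun d e _ _ x y => sup_sup_distrib_right _ _ _
  · refine fun d _ hdu hdS => ⟨fun x y z => max_le ?_ ?_, fun x y => ?_⟩
    · exact (hdu _ (r y) _).trans (max_le_max (le_max_left _ _) (le_max_left _ _))
    · exact (ρu x y z).trans (max_le_max (le_max_right _ _) (le_max_right _ _))
    · rcases max_choice (d (r x) (r y)) (ρ x y) with h | h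
      · exact (show Sig d x y = _ from h) ▸ hdS _ _
      · exact (show Sig d x y = _ from h) ▸ ρS _ _
  · intro d hd hdc x hx
    have hρ : ∀ n, ∃ K, ∀ k ≥ K, ∀ l ≥ K, ρ (x k) (x l) < s n := fun n =>
      let ⟨K, hK⟩ := hx (s n) (hspos n)
      ⟨K, fun k hk l hl => (max_lt_iff.1 (hK k hk l hl)).2⟩
    by_cases hnear : ∀ n, ∃ K, ∀ k ≥ K, InSaturation E F n (x k)
    · obtain ⟨a, ha⟩ := hdc (fun k => r (x k)) fun ε hε =>
        let ⟨K, hK⟩ := hx ε hε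
        ⟨K, fun k hk l hl => (max_lt_iff.1 (hK k hk l hl)).1⟩
      refine ⟨a, ?_⟩
      have hρa : Tendsto (fun k => ρ (x k) a) atTop (𝓝 0) := by
        refine Metric.tendsto_atTop.2 fun ε hε => ?_
        obtain ⟨n, hn⟩ := hsmall ε hε
        obtain ⟨K, hK⟩ := hnear n
        refine ⟨K, fun k hk => ?_⟩
        rw [Real.dist_0_eq_abs, abs_of_nonneg (ρ0 _ _)]
        exact ((ρlt n _ _).2 (Or.inr ⟨hK k hk, hE.inSaturation_of_mem a.2 n⟩)).trans hn
      simpa only [Sig, hrF, max_self] using ha.max hρa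
    · push Not at hnear
      obtain ⟨n, hn⟩ := hnear
      obtain ⟨l, hl⟩ := hE.complete x fun m => by
        obtain ⟨K, hK⟩ := hρ (max m n)
        obtain ⟨j, hj, hjn⟩ := hn K
        have hjE : ∀ k ≥ K, E (max m n) (x j) (x k) := fun k hk =>
          ρE (fun h => hjn (hE.inSaturation_anti (le_max_right m n) h)) (hK j hj k hk)
        exact ⟨K, fun k hk l hl => hE.anti (le_max_left m n)
          ((hE.equiv _).trans ((hE.equiv _).symm (hjE k hk)) (hjE l hl))⟩
      exact ⟨l, (hcompat d hd).tendsto_iff.2 hl⟩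
end

section
/- Let X be a topological space admitting a compatible ultrametric, let F be a nonempty closed subset of X, let S be a characteristic subset of [0, ∞), and fix η > 0. Then there exists a map Σ : Met(F) → Met(X) satisfying properties (1)–(5) (extension; u^S-isometry; monotonicity; compatibility with pointwise maxima; preservation of S-valued ultrametrics) and, in addition, for every d ∈ Met(F) the set F is η-dense in (X, Σ(d)): for every x ∈ X there exists a ∈ F with Σ(d)(x, a) ≤ η. -/
/-- A characteristic set contains the values of a nondecreasing gauge `φ` bounded by `η`,
which vanishes at `0`, is positive on `(0, ∞)` and is small near `0`. -/
lemma CharacteristicSet.exists_gauge {S : Set ℝ} (hS : CharacteristicSet S) {η : ℝ}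
    (hη : 0 < η) :
    ∃ φ : ℝ → ℝ, Monotone φ ∧ (∀ t, φ t ∈ S) ∧ (∀ t, φ t ≤ η) ∧ φ 0 = 0 ∧
      (∀ t, 0 < t → 0 < φ t) ∧ ∀ ε > 0, ∃ δ > 0, ∀ t < δ, φ t < ε := by
  obtain ⟨-, h0, hsmall⟩ := hS
  choose! c hcS hc0 hcle using hsmall
  let s : ℕ → ℝ := fun n => Nat.rec (c η) (fun n t => c (min t (1 / ((n : ℝ) + 1)))) n
  have hs0 : ∀ n, 0 < s n := by
    intro n
    induction n with
    | zero => exact hc0 _ hη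
    | succ n ih => exact hc0 _ (lt_min ih (by positivity))
  have hmin : ∀ n : ℕ, 0 < min (s n) (1 / ((n : ℝ) + 1)) := fun n =>
    lt_min (hs0 n) (by positivity)
  have hsS : ∀ n, s n ∈ S := by
    rintro (_ | n)
    · exact hcS _ hη
    · exact hcS _ (hmin n)
  have hanti : Antitone s :=
    antitone_nat_of_succ_le fun n => (hcle _ (hmin n)).trans (min_le_left _ _)
  have hsη : ∀ n, s n ≤ η := fun n => (hanti (Nat.zero_le n)).trans (hcle _ hη)
  refine ⟨fun t => if 0 < t then s ⌊1 / t⌋₊ else 0, ?_, ?_, ?_, by simp, ?_, ?_⟩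
  · intro a b hab
    dsimp only
    split_ifs with ha hb hb
    · exact hanti (Nat.floor_le_floor (one_div_le_one_div_of_le ha hab))
    · exact absurd (ha.trans_le hab) hb
    · exact (hs0 _).le
    · exact le_rfl
  · intro t
    dsimp only
    split_ifs
    exacts [hsS _, h0]
  · intro t
    dsimp only
    split_ifs
    exacts [hsη _, hη.le]
  · intro t ht
    simpa [ht] using hs0 _
  · intro ε hε
    obtain ⟨n, hn⟩ := exists_nat_one_div_lt hε
    refine ⟨1 / ((n : ℝ) + 1), by positivity, fun t ht => ?_⟩
    dsimp only
    split_ifs with h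
    · have hle : n + 1 ≤ ⌊1 / t⌋₊ := by
        apply Nat.le_floor
        push_cast
        rw [le_one_div (by positivity) h]
        exact ht.le
      exact ((hanti hle).trans ((hcle _ (hmin n)).trans (min_le_right _ _))).trans_lt hn
    · exact hε

/-- The distance to a nonempty closed subset, for a compatible ultrametric. -/
lemma exists_distance_to_closed {X : Type*} [TopologicalSpace X] {u : X → X → ℝ}
    (hu : IsCompatMetric X u) (hult : IsUltrametricFun u) {F : Set X} (hFne : F.Nonempty)
    (hFcl : IsClosed F) :
    ∃ h : X → ℝ, (∀ x ∈ F, h x = 0) ∧ (∀ x ∉ F, 0 < h x) ∧ (∀ x, ∀ a ∈ F, h x ≤ u x a) ∧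
      (∀ x y, h x ≤ max (u x y) (h y)) ∧ ∀ x ∉ F, ∃ a ∈ F, u x a < 2 * h x := by
  obtain ⟨hnn, -, -, hzero, hnhds⟩ := hu
  have : Nonempty F := hFne.to_subtype
  have hbdd : ∀ x, BddBelow (Set.range fun a : F => u x a) := fun x =>
    ⟨0, by rintro _ ⟨a, rfl⟩; exact hnn _ _⟩
  have hle : ∀ x, ∀ a ∈ F, (⨅ a : F, u x a) ≤ u x a := fun x a ha => ciInf_le (hbdd x) ⟨a, ha⟩
  have hpos : ∀ x ∉ F, 0 < ⨅ a : F, u x a := by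
    intro x hx
    obtain ⟨ε, hε, hsub⟩ := (hnhds x Fᶜ).1 (hFcl.isOpen_compl.mem_nhds hx)
    refine hε.trans_le (le_ciInf fun a => ?_)
    by_contra! hlt
    exact hsub hlt a.2
  refine ⟨fun x => ⨅ a : F, u x a, ?_, hpos, hle, ?_, ?_⟩
  · intro x hx
    exact le_antisymm ((hle x x hx).trans_eq ((hzero x x).2 rfl)) (le_ciInf fun a => hnn _ _)
  · intro x y
    refine le_of_forall_pos_lt_add fun ε hε => ?_
    obtain ⟨a, ha⟩ := exists_lt_of_ciInf_lt (lt_add_of_pos_right (⨅ a : F, u y a) hε)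
    refine (hle x a a.2).trans_lt ((hult x y a).trans_lt ?_)
    rw [← max_add_add_right]
    exact max_lt (lt_max_of_lt_left (by linarith)) (lt_max_of_lt_right ha)
  · intro x hx
    obtain ⟨a, ha⟩ := exists_lt_of_ciInf_lt
      (show (⨅ a : F, u x a) < 2 * ⨅ a : F, u x a by linarith [hpos x hx])
    exact ⟨a, a.2, ha⟩

/-- A nonempty closed subset of an ultrametric space is a retract, by a retraction that moves
points by at most twice their distance `h` to the subset. -/
lemma exists_continuous_retraction {X : Type*} [TopologicalSpace X] {u : X → X → ℝ}
    (hu : IsCompatMetric X u) (hult : IsUltrametricFun u) {F : Set X} {h : X → ℝ}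
    (hpos : ∀ x ∉ F, 0 < h x) (hle : ∀ x, ∀ a ∈ F, h x ≤ u x a)
    (hmax : ∀ x y, h x ≤ max (u x y) (h y)) (hnear : ∀ x ∉ F, ∃ a ∈ F, u x a < 2 * h x) :
    ∃ r : X → F, Continuous r ∧ (∀ a : F, r a = a) ∧ ∀ x ∉ F, u x (r x) ≤ 2 * h x := by
  classical
  obtain ⟨-, hsymm, -, -, hnhds⟩ := hu
  let T : X → Set F := fun x => {a | u x a < 2 * h x}
  have hT : ∀ x ∉ F, (T x).Nonempty := fun x hx =>
    let ⟨a, ha, hlt⟩ := hnear x hx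
    ⟨⟨a, ha⟩, hlt⟩
  have hloc : ∀ x y, x ∉ F → u x y < h x → y ∉ F ∧ T y = T x := by
    intro x y hx hxy
    have hyF : y ∉ F := fun hy => (hle x y hy).not_gt hxy
    have hheq : h y = h x := by
      apply le_antisymm
      · exact (hmax y x).trans (max_le (by rw [hsymm]; exact hxy.le) le_rfl)
      · exact (le_max_iff.1 (hmax x y)).resolve_left hxy.not_ge
    have hx0 := hpos x hx
    refine ⟨hyF, Set.ext fun a => ?_⟩
    change u y a < 2 * h y ↔ u x a < 2 * h x
    rw [hheq]
    constructor
    · exact fun H => (hult x y a).trans_lt (max_lt (by linarith) H)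
    · exact fun H => (hult y x a).trans_lt (max_lt (by rw [hsymm]; linarith) H)
  have hsome : ∀ {A B : Set F} (hA : A.Nonempty) (hB : B.Nonempty), A = B →
      hA.some = hB.some := by
    rintro A B hA hB rfl
    rfl
  let r : X → F := fun x => if hx : x ∈ F then ⟨x, hx⟩ else (hT x hx).some
  have hrF : ∀ a : F, r a = a := fun a => dif_pos a.2
  have hrc : ∀ x (hx : x ∉ F), r x = (hT x hx).some := fun x hx => dif_neg hx
  have hr2 : ∀ x ∉ F, u x (r x) ≤ 2 * h x := by
    intro x hx
    rw [hrc x hx]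
    exact (hT x hx).some_mem.le
  refine ⟨r, continuous_iff_continuousAt.2 fun x => ?_, hrF, hr2⟩
  by_cases hx : x ∈ F
  · rw [ContinuousAt, tendsto_subtype_rng, hrF ⟨x, hx⟩]
    intro s hs
    obtain ⟨ε, hε, hsub⟩ := (hnhds x s).1 hs
    refine (hnhds x _).2 ⟨ε / 2, half_pos hε, fun y hy => hsub ?_⟩
    change u x y < ε / 2 at hy
    change u x (r y) < ε
    by_cases hyF : y ∈ F
    · rw [hrF ⟨y, hyF⟩]
      exact hy.trans (half_lt_self hε)
    · have h1 := hr2 y hyF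
      have h2 := hle y x hx
      rw [hsymm y x] at h2
      exact (hult x y (r y)).trans_lt (max_lt (by linarith) (by linarith))
  · refine (continuousAt_const (y := r x)).congr ((hnhds x _).2 ⟨h x, hpos x hx, fun y hy => ?_⟩)
    obtain ⟨hyF, hTy⟩ := hloc x y hx hy
    change r x = r y
    rw [hrc x hx, hrc y hyF]
    exact hsome _ _ hTy.symm

lemma uDist_congr {Y Z : Type*} {S : Set ℝ} {d e : Y → Y → ℝ} {d' e' : Z → Z → ℝ}
    (H : ∀ ε > 0, (∀ x y, d x y ≤ max (e x y) ε ∧ e x y ≤ max (d x y) ε) ↔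
      ∀ x y, d' x y ≤ max (e' x y) ε ∧ e' x y ≤ max (d' x y) ε) :
    uDist S d e = uDist S d' e' := by
  unfold uDist
  congr 2
  ext ε
  exact and_congr_right fun _ => and_congr_right fun hε => H ε hε

/-- The ultrametric obtained by collapsing the zero set of `h` to a point. -/
lemma isUltrametricFun_collapse {X : Type*} {u : X → X → ℝ} (hsymm : ∀ x y, u x y = u y x)
    (hult : IsUltrametricFun u) {h : X → ℝ} (hmax : ∀ x y, h x ≤ max (u x y) (h y)) :
    IsUltrametricFun fun x y => min (u x y) (max (h x) (h y)) := by
  intro x y z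
  have h1 := hult x y z
  have h2 := hmax x y
  have h3 := hmax z y
  rw [hsymm z y] at h3
  grind

/-- Gluing a metric `d` on `F`, pulled back along a retraction `r`, with a continuous
pseudo-ultrametric `w` gives a compatible metric. -/
lemma IsCompatMetric.max_retraction {X : Type*} [TopologicalSpace X] {F : Set X} {d : F → F → ℝ}
    (hd : IsCompatMetric F d) {r : X → F} (hr : Continuous r) {w : X → X → ℝ}
    (hT0 : T0Space X) (hnn : ∀ x y, 0 ≤ w x y) (hself : ∀ x, w x x = 0)
    (hsymm : ∀ x y, w x y = w y x) (hult : IsUltrametricFun w)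
    (hcont : ∀ x, ∀ ε > 0, {y | w x y < ε} ∈ nhds x)
    (hsep : ∀ x, ∀ s ∈ nhds x, ∃ t ∈ nhds (r x), ∃ ε > 0, ∀ y, r y ∈ t → w x y < ε → y ∈ s) :
    IsCompatMetric X fun x y => max (d (r x) (r y)) (w x y) := by
  obtain ⟨-, dsymm, dtri, dzero, dnhds⟩ := hd
  have hself' : ∀ x, max (d (r x) (r x)) (w x x) = 0 := fun x => by
    rw [(dzero _ _).2 rfl, hself, max_self]
  have hnhds : ∀ x : X, ∀ s : Set X,
      s ∈ nhds x ↔ ∃ ε > 0, {y | max (d (r x) (r y)) (w x y) < ε} ⊆ s := by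
    intro x s
    constructor
    · intro hs
      obtain ⟨t, ht, ε, hε, H⟩ := hsep x s hs
      obtain ⟨δ, hδ, hsub⟩ := (dnhds (r x) t).1 ht
      refine ⟨min δ ε, lt_min hδ hε, fun y hy => ?_⟩
      obtain ⟨h1, h2⟩ : d (r x) (r y) < min δ ε ∧ w x y < min δ ε := max_lt_iff.1 hy
      exact H y (hsub (h1.trans_le (min_le_left _ _))) (h2.trans_le (min_le_right _ _))
    · rintro ⟨ε, hε, hsub⟩
      have hb : {b | d (r x) b < ε} ∈ nhds (r x) := (dnhds _ _).2 ⟨ε, hε, subset_rfl⟩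
      filter_upwards [hr.continuousAt hb, hcont x ε hε] with y h1 h2
      exact hsub (max_lt h1 h2)
  have hsymm' : ∀ x y, max (d (r x) (r y)) (w x y) = max (d (r y) (r x)) (w y x) := fun x y => by
    rw [dsymm, hsymm]
  refine ⟨fun x y => le_max_of_le_right (hnn x y), hsymm', ?_, ?_, hnhds⟩
  · intro x y z
    have h1 := dtri (r x) (r y) (r z)
    have h2 := hult x y z
    have h3 := hnn x y
    have h4 := hnn y z
    grind
  · intro x y
    refine ⟨fun hxy => ?_, by rintro rfl; exact hself' x⟩
    dsimp only at hxy
    refine Inseparable.eq ((specializes_iff_pure.2 ?_).antisymm (specializes_iff_pure.2 ?_))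
    · intro s hs
      obtain ⟨ε, hε, hsub⟩ := (hnhds y s).1 hs
      refine hsub ?_
      change max (d (r y) (r x)) (w y x) < ε
      rwa [hsymm', hxy]
    · intro s hs
      obtain ⟨ε, hε, hsub⟩ := (hnhds x s).1 hs
      refine hsub ?_
      change max (d (r x) (r y)) (w x y) < ε
      rwa [hxy]

lemma IsCompatMetric.t0Space {X : Type*} [TopologicalSpace X] {u : X → X → ℝ}
    (hu : IsCompatMetric X u) : T0Space X := by
  obtain ⟨hnn, -, -, hzero, hnhds⟩ := hu
  refine ⟨fun x y hxy => (hzero x y).1 (le_antisymm ?_ (hnn x y))⟩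
  by_contra! hpos
  have hmem : {z | u x z < u x y} ∈ nhds y := by
    rw [← hxy.nhds_eq]
    exact (hnhds x _).2 ⟨_, hpos, subset_rfl⟩
  have hy : y ∈ {z | u x z < u x y} := mem_of_mem_nhds hmem
  exact lt_irrefl (u x y) hy

theorem exists_ultrametric_extensor_dense {X : Type*} [TopologicalSpace X]
    (hu : ∃ u : X → X → ℝ, IsCompatMetric X u ∧ IsUltrametricFun u)
    (F : Set X) (hFne : F.Nonempty) (hFcl : IsClosed F)
    (S : Set ℝ) (hS : CharacteristicSet S) (η : ℝ) (hη : 0 < η) :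
    ∃ Sig : (↥F → ↥F → ℝ) → (X → X → ℝ),
      (∀ d, IsCompatMetric ↥F d → IsCompatMetric X (Sig d)) ∧
      -- (1) extension
      (∀ d, IsCompatMetric ↥F d → ∀ a b : ↥F, Sig d (a : X) (b : X) = d a b) ∧
      -- (2) u^S-isometry
      (∀ d e, IsCompatMetric ↥F d → IsCompatMetric ↥F e →
        uDist S (Sig d) (Sig e) = uDist S d e) ∧
      -- (3) monotonicity
      (∀ d e, IsCompatMetric ↥F d → IsCompatMetric ↥F e →
        (∀ a b : ↥F, d a b ≤ e a b) → ∀ x y : X, Sig d x y ≤ Sig e x y) ∧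
      -- (4) compatibility with pointwise maxima
      (∀ d e, IsCompatMetric ↥F d → IsCompatMetric ↥F e →
        ∀ x y : X, Sig (fun a b => max (d a b) (e a b)) x y = max (Sig d x y) (Sig e x y)) ∧
      -- (5) preservation of S-valued ultrametrics
      (∀ d, IsCompatMetric ↥F d → IsUltrametricFun d → (∀ a b : ↥F, d a b ∈ S) →
        IsUltrametricFun (Sig d) ∧ ∀ x y : X, Sig d x y ∈ S) ∧
      -- F is η-dense in (X, Sig d)
      (∀ d, IsCompatMetric ↥F d → ∀ x : X, ∃ a ∈ F, Sig d x a ≤ η) := by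
  obtain ⟨u, hu, hult⟩ := hu
  obtain ⟨φ, hmono, hφS, hφη, hφ0, hφpos, hφlim⟩ := hS.exists_gauge hη
  obtain ⟨h, hF0, hpos, hle, hmax, hnear⟩ := exists_distance_to_closed hu hult hFne hFcl
  obtain ⟨r, hr, hrF, hr2⟩ := exists_continuous_retraction hu hult hpos hle hmax hnear
  have hT0 := hu.t0Space
  obtain ⟨unn, usymm, -, uzero, unhds⟩ := hu
  have hnn : ∀ x, 0 ≤ h x := fun x => by
    by_cases hx : x ∈ F
    exacts [(hF0 x hx).ge, (hpos x hx).le]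
  obtain ⟨m, hm⟩ : ∃ m : X → X → ℝ, m = fun x y => min (u x y) (max (h x) (h y)) := ⟨_, rfl⟩
  have hm' : ∀ x y, m x y = min (u x y) (max (h x) (h y)) := fun x y => by rw [hm]
  have mult : IsUltrametricFun m := hm ▸ isUltrametricFun_collapse usymm hult hmax
  have mnn : ∀ x y, 0 ≤ m x y := fun x y => by
    rw [hm']
    exact le_min (unn x y) (le_max_of_le_left (hnn x))
  have wnn : ∀ x y, 0 ≤ φ (m x y) := fun x y => hφ0.symm.trans_le (hmono (mnn x y))
  have wult : IsUltrametricFun fun x y => φ (m x y) := fun x y z =>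
    (hmono (mult x y z)).trans_eq hmono.map_max
  have wF : ∀ a b : F, φ (m a b) = 0 := fun a b => by
    rw [hm', hF0 a a.2, hF0 b b.2, max_self, min_eq_right (unn _ _), hφ0]
  have hsep : ∀ x, ∀ s ∈ nhds x, ∃ t ∈ nhds (r x), ∃ ε > 0,
      ∀ y, r y ∈ t → φ (m x y) < ε → y ∈ s := by
    intro x s hs
    obtain ⟨ε, hε, hsub⟩ := (unhds x s).1 hs
    by_cases hx : x ∈ F
    · refine ⟨{b | u x b < ε}, ?_, φ (ε / 2), hφpos _ (half_pos hε), fun y hy hφy => hsub ?_⟩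
      · rw [hrF ⟨x, hx⟩]
        have hball : {b | u x b < ε} ∈ nhds x := (unhds x _).2 ⟨ε, hε, subset_rfl⟩
        exact continuous_subtype_val.continuousAt (x := (⟨x, hx⟩ : F)) hball
      · change u x (r y) < ε at hy
        change u x y < ε
        by_cases hyF : y ∈ F
        · rwa [hrF ⟨y, hyF⟩] at hy
        · have hlt := hmono.reflect_lt hφy
          rw [hm', min_lt_iff, max_lt_iff] at hlt
          rcases hlt with hlt | ⟨-, hlt⟩
          · linarith
          · refine (hult x (r y) y).trans_lt (max_lt hy ?_)
            rw [usymm]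
            linarith [hr2 y hyF]
    · have hδ : 0 < min ε (h x) := lt_min hε (hpos x hx)
      refine ⟨Set.univ, Filter.univ_mem, φ (min ε (h x)), hφpos _ hδ, fun y _ hφy => hsub ?_⟩
      have hlt := hmono.reflect_lt hφy
      rw [hm', min_lt_iff] at hlt
      rcases hlt with hlt | hlt
      · exact hlt.trans_le (min_le_left _ _)
      · exact absurd ((le_max_left _ _).trans_lt (hlt.trans_le (min_le_right _ _))) (lt_irrefl _)
  have hext : ∀ d, IsCompatMetric F d → ∀ a b : F,
      max (d (r a) (r b)) (φ (m a b)) = d a b := fun d hd a b => by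
    rw [hrF, hrF, wF, max_eq_left (hd.1 a b)]
  refine ⟨fun d x y => max (d (r x) (r y)) (φ (m x y)), ?_, hext, ?_, ?_, ?_, ?_, ?_⟩
  · intro d hd
    refine hd.max_retraction hr hT0 wnn (fun x => ?_) (fun x y => ?_) wult (fun x ε hε => ?_) hsep
    · rw [hm', (uzero x x).2 rfl, min_eq_left (le_max_of_le_left (hnn x)), hφ0]
    · rw [hm', hm', usymm, max_comm]
    · obtain ⟨δ, hδ, H⟩ := hφlim ε hε
      refine (unhds x _).2 ⟨δ, hδ, fun y hy => H _ ?_⟩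
      rw [hm']
      exact (min_le_left _ _).trans_lt hy
  · intro d e hd he
    refine uDist_congr fun ε _ => ⟨fun H a b => ?_, fun H x y => ?_⟩
    · have := H a b
      dsimp only at this
      rwa [hext d hd, hext e he] at this
    · have := H (r x) (r y)
      grind
  · exact fun d e _ _ hde x y => max_le_max_right _ (hde _ _)
  · exact fun d e _ _ x y => sup_sup_distrib_right _ _ _
  · intro d _ hdult hdS
    refine ⟨fun x y z => ?_, fun x y => ?_⟩
    · have h1 := hdult (r x) (r y) (r z)
      have h2 := wult x y z
      grind
    · dsimp only
      rcases max_choice (d (r x) (r y)) (φ (m x y)) with H | H <;> rw [H]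
      exacts [hdS _ _, hφS _]
  · intro d hd x
    refine ⟨r x, (r x).2, ?_⟩
    dsimp only
    rw [hrF, (hd.2.2.2.1 _ _).2 rfl]
    exact max_le hη.le (hφη _)
end
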